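/- arXiv:math/0611356 — 3 statements merged into one kernel-verified Lean document; each statement's English description precedes it below -/
import Mathlib

section
/- Define β₁ = 1, β₂ = 2, and β_{s+1} = 2β_s + β_{s−1} for s ≥ 2, and for each natural number s let b_s = min{b : there exist natural numbers a, c with a ≤ b and |𝒩(a,b,c)| ≥ s}. Then b_{2s} = β_s and b_{2s+1} = β_s + β_{s−1}. -/
/-- `𝒩(a,b,c)`: the set of vertices (extreme points) of the convex hull of
`{(x,y) ∈ ℤ² : x ≥ 0, y ≥ 0, ax + by ≤ c}`, the two-dimensional knapsack polytope. -/
def twoKnapVert (a b c : ℕ) : Set (ℝ × ℝ) :=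
  Set.extremePoints ℝ (convexHull ℝ
    {p : ℝ × ℝ | (∃ x : ℤ, p.1 = (x : ℝ)) ∧ (∃ y : ℤ, p.2 = (y : ℝ)) ∧
      0 ≤ p.1 ∧ 0 ≤ p.2 ∧ (a : ℝ) * p.1 + (b : ℝ) * p.2 ≤ (c : ℝ)})

/-- The sequence `β₁ = 1, β₂ = 2, β_{s+1} = 2β_s + β_{s−1}` (`s ≥ 2`), extended by
`β₀ = 0` (which is consistent with the recurrence). -/
def beta : ℕ → ℕ
  | 0 => 0
  | 1 => 1
  | n + 2 => 2 * beta (n + 1) + beta n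

def InS (a b r0 x r : ℤ) : Prop := 0 ≤ x ∧ 0 ≤ r ∧ b ∣ r - r0 + a * x

def Edg (a b r0 : ℤ) (l : ℝ) : Prop :=
  0 < l ∧ ∃ x1 r1 x2 r2 : ℤ, InS a b r0 x1 r1 ∧ InS a b r0 x2 r2 ∧ r2 < r1 ∧
    l * x1 + r1 = l * x2 + r2 ∧ ∀ x r : ℤ, InS a b r0 x r → l * x1 + r1 ≤ l * x + r

lemma InS_congr {a b r0 a' r0' : ℤ} (ha : b ∣ a - a') (hr : b ∣ r0 - r0') (x r : ℤ) :
    InS a b r0 x r ↔ InS a' b r0' x r := by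
  unfold InS
  have : b ∣ (r - r0 + a * x) - (r - r0' + a' * x) := by
    have : (r - r0 + a * x) - (r - r0' + a' * x) = (a - a') * x - (r0 - r0') := by ring
    rw [this]
    exact dvd_sub (Dvd.dvd.mul_right ha x) hr
  rw [dvd_iff_dvd_of_dvd_sub this]

lemma Edg_congr {a b r0 a' r0' : ℤ} (ha : b ∣ a - a') (hr : b ∣ r0 - r0') (l : ℝ)
    (h : Edg a b r0 l) : Edg a' b r0' l := by
  unfold Edg at *
  simpa only [InS_congr ha hr] using h

lemma Edg_mod {a b r0 : ℤ} {l : ℝ} (h : Edg a b r0 l) : Edg (a % b) b (r0 % b) l :=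
  Edg_congr (Int.dvd_self_sub_emod) (Int.dvd_self_sub_emod) l h

lemma transR {a b e r0 : ℤ} {l : ℝ} (he : 0 < e) (ha : 0 ≤ a) (hb : b = a + e) (hr0 : 0 ≤ r0)
    (hre : r0 < e) (h : Edg a b r0 l) : Edg a e r0 (l * b / (l + e)) := by
  obtain ⟨hl, x1, r1, x2, r2, h1, h2, h12, heq, hmin⟩ := h
  have heR : (0 : ℝ) < e := by exact_mod_cast he
  have hbR : (0 : ℝ) < b := by exact_mod_cast (by omega : 0 < b)
  have hle : 0 < l + e := by positivity
  have h0 := hmin 0 r0 ⟨le_rfl, hr0, by simp⟩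
  have key : ∀ x r : ℤ, InS a b r0 x r → l * x + r ≤ r0 →
      ∃ q : ℤ, InS a e r0 q r ∧ e * x = r - r0 + b * q := by
    rintro x r ⟨hx, hr, y, hy⟩ hle0
    refine ⟨x - y, ⟨?_, hr, x - (x - y), ?_⟩, ?_⟩
    · by_contra hneg
      have : r0 < r := by
        subst hb
        have : r = r0 + e * x + (a + e) * (y - x) := by linear_combination hy
        nlinarith [mul_nonneg he.le hx, mul_nonneg (by omega : 0 ≤ a + e) (by omega : 0 ≤ y - x - 1)]
      have h3 : (r0 : ℝ) < r := by exact_mod_cast this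
      have : (0 : ℝ) ≤ x := by exact_mod_cast hx
      nlinarith [mul_nonneg hl.le this]
    · subst hb; linear_combination hy
    · subst hb; linear_combination -hy
  have h0' : l * x1 + r1 ≤ r0 := by simpa using h0
  obtain ⟨q1, hq1, e1⟩ := key x1 r1 h1 h0'
  obtain ⟨q2, hq2, e2⟩ := key x2 r2 h2 (heq ▸ h0')
  have id : ∀ x r q : ℤ, e * x = r - r0 + b * q →
      (l * b / (l + e)) * q + r = (e * (l * x + r) + l * r0) / (l + e) := by
    intro x r q hh
    have hh' : (e : ℝ) * x = r - r0 + b * q := by exact_mod_cast hh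
    field_simp
    linear_combination -l * hh'
  refine ⟨by positivity, q1, r1, q2, r2, hq1, hq2, h12, ?_, ?_⟩
  · rw [id _ _ _ e1, id _ _ _ e2, heq]
  · rintro q r ⟨hq, hr, x, hx⟩
    have hxe : e * (x + q) = r - r0 + b * q := by subst hb; linear_combination -hx
    have hbq : 0 ≤ b * q := mul_nonneg (by omega) hq
    have hx0 : 0 ≤ x + q := by
      by_contra hneg
      nlinarith [mul_nonneg he.le (by omega : 0 ≤ -(x+q) - 1)]
    have := hmin (x + q) r ⟨hx0, hr, x, by subst hb; linear_combination hx⟩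
    rw [id _ _ _ e1, id _ _ _ hxe]
    gcongr

lemma trans3 {a b e r0 : ℤ} {l : ℝ} (he : 0 < e) (ha : 0 ≤ a) (hb : b = a + e) (hr0 : 0 ≤ r0)
    (hre : r0 < b) (h : Edg a b r0 l) : Edg a e (r0 - b) (l * b / (l + e)) ∨
      ((∃ x r : ℤ, InS a b r0 x r ∧ r < r0 ∧ l * x + r = r0) ∧
        ∀ x r : ℤ, InS a b r0 x r → r0 ≤ l * x + r) := by
  obtain ⟨hl, x1, r1, x2, r2, h1, h2, h12, heq, hmin⟩ := h
  have heR : (0 : ℝ) < e := by exact_mod_cast he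
  have hbR : (0 : ℝ) < b := by exact_mod_cast (by omega : 0 < b)
  have hle : 0 < l + e := by positivity
  have h0 := hmin 0 r0 ⟨le_rfl, hr0, by simp⟩
  have key : ∀ x r : ℤ, InS a b r0 x r → l * x + r ≤ r0 → r ≠ r0 →
      ∃ q : ℤ, InS a e (r0 - b) q r ∧ e * x = r - r0 + b * (q + 1) := by
    rintro x r ⟨hx, hr, y, hy⟩ hle0 hne
    have hxR : (0 : ℝ) ≤ x := by exact_mod_cast hx
    have hrr : r ≤ r0 := by
      have : (r : ℝ) ≤ r0 := by nlinarith [mul_nonneg hl.le hxR]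
      exact_mod_cast this
    refine ⟨x - y - 1, ⟨?_, hr, y + 1, ?_⟩, ?_⟩
    · by_contra hneg
      have : r0 ≤ r := by
        subst hb
        have : r = r0 + e * x + (a + e) * (y - x) := by linear_combination hy
        nlinarith [mul_nonneg he.le hx, mul_nonneg (by omega : 0 ≤ a + e) (by omega : 0 ≤ y - x)]
      omega
    · subst hb; linear_combination hy
    · subst hb; linear_combination -hy
  have h0' : l * x1 + r1 ≤ r0 := by simpa using h0
  have hx1R : (0 : ℝ) ≤ x1 := by exact_mod_cast h1.1
  have hr1 : r1 ≤ r0 := by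
    have : (r1 : ℝ) ≤ r0 := by nlinarith [mul_nonneg hl.le hx1R]
    exact_mod_cast this
  by_cases hr10 : r1 = r0
  · right
    have : l * x1 + r1 = r0 := by
      apply le_antisymm h0'
      rw [hr10]; nlinarith [mul_nonneg hl.le hx1R]
    refine ⟨⟨x2, r2, h2, by omega, by rw [← heq, this]⟩, fun x r hh => ?_⟩
    rw [← this]; exact hmin x r hh
  left
  obtain ⟨q1, hq1, e1⟩ := key x1 r1 h1 h0' hr10
  obtain ⟨q2, hq2, e2⟩ := key x2 r2 h2 (heq ▸ h0') (by omega)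
  have id : ∀ x r q : ℤ, e * x = r - r0 + b * (q + 1) →
      (l * b / (l + e)) * q + r = (e * (l * x + r) + l * r0 - l * b) / (l + e) := by
    intro x r q hh
    have hh' : (e : ℝ) * x = r - r0 + b * (q + 1) := by exact_mod_cast hh
    field_simp
    linear_combination -l * hh'
  refine ⟨by positivity, q1, r1, q2, r2, hq1, hq2, h12, ?_, ?_⟩
  · rw [id _ _ _ e1, id _ _ _ e2, heq]
  · rintro q r ⟨hq, hr, x, hx⟩
    have hxe : e * (x + q) = r - r0 + b * (q + 1) := by subst hb; linear_combination -hx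
    have hbq : 0 ≤ b * q := mul_nonneg (by omega) hq
    have hx0 : 0 ≤ x + q := by
      by_contra hneg
      nlinarith [mul_nonneg he.le (by omega : 0 ≤ -(x+q) - 1)]
    have := hmin (x + q) r ⟨hx0, hr, x - 1, by subst hb; linear_combination hx⟩
    rw [id _ _ _ e1, id _ _ _ hxe]
    gcongr

lemma trans1 {a b r0 : ℤ} {l : ℝ} (ha : 0 < a) (hr0 : 0 ≤ r0)
    (hre : r0 < b) (h : Edg a b r0 l) (hla : l ≠ a) :
    l < a ∧ Edg (-b) a r0 (l * b / (a - l)) := by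
  obtain ⟨hl, x1, r1, x2, r2, h1, h2, h12, heq, hmin⟩ := h
  have haR : (0 : ℝ) < a := by exact_mod_cast ha
  have hb : 0 < b := by omega
  have hbR : (0 : ℝ) < b := by exact_mod_cast hb
  have h0 := hmin 0 r0 ⟨le_rfl, hr0, by simp⟩
  have h0' : l * x1 + r1 ≤ r0 := by simpa using h0
  have key : ∀ x r : ℤ, InS a b r0 x r →
      ∃ y : ℤ, InS (-b) a r0 y r ∧ a * x = r0 + b * y - r := by
    rintro x r ⟨hx, hr, y, hy⟩
    refine ⟨y, ⟨?_, hr, -x, ?_⟩, ?_⟩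
    · by_contra hneg
      nlinarith [mul_nonneg ha.le hx, mul_nonneg hb.le (by omega : 0 ≤ - y - 1)]
    · linear_combination hy
    · linear_combination hy
  obtain ⟨y1, hy1, e1⟩ := key x1 r1 h1
  obtain ⟨y2, hy2, e2⟩ := key x2 r2 h2
  have hla' : l < a := by
    by_contra hcon
    have hgt : (a : ℝ) < l := lt_of_le_of_ne (not_lt.mp hcon) (Ne.symm hla)
    have e2' : (a : ℝ) * x2 = r0 + b * y2 - r2 := by exact_mod_cast e2
    have e1' : (a : ℝ) * x1 = r0 + b * y1 - r1 := by exact_mod_cast e1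
    have hx2 : (0 : ℝ) ≤ x2 := by exact_mod_cast h2.1
    have hx1 : (0 : ℝ) ≤ x1 := by exact_mod_cast h1.1
    have hy2 : (0 : ℝ) ≤ y2 := by exact_mod_cast hy2.1
    have hr : (r2 : ℝ) < r1 := by exact_mod_cast h12
    have hx21 : x1 < x2 := by
      by_contra hc
      have : (x2 : ℝ) ≤ x1 := by exact_mod_cast not_lt.mp hc
      nlinarith
    have hx2p : (0 : ℝ) < x2 := lt_of_le_of_lt hx1 (by exact_mod_cast hx21)
    nlinarith [mul_pos (sub_pos.mpr hgt) hx2p, mul_nonneg hbR.le hy2]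
  refine ⟨hla', ?_⟩
  have hle : 0 < a - l := sub_pos.mpr hla'
  have id : ∀ x r y : ℤ, a * x = r0 + b * y - r →
      (l * b / (a - l)) * y + r = (a * (l * x + r) - l * r0) / (a - l) := by
    intro x r y hh
    have hh' : (a : ℝ) * x = r0 + b * y - r := by exact_mod_cast hh
    field_simp
    linear_combination -l * hh'
  refine ⟨by positivity, y1, r1, y2, r2, hy1, hy2, h12, ?_, ?_⟩
  · rw [id _ _ _ e1, id _ _ _ e2, heq]
  · rintro y r ⟨hy, hr, x, hx⟩
    have hxe : a * (-x) = r0 + b * y - r := by linear_combination hx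
    rw [id _ _ _ e1]
    by_cases hx0 : 0 ≤ -x
    · have := hmin (-x) r ⟨hx0, hr, y, by linear_combination hx⟩
      rw [id _ _ _ hxe]
      gcongr
    · have hr0r : r0 ≤ r := by
        nlinarith [mul_nonneg hb.le hy, mul_nonneg ha.le (by omega : 0 ≤ x)]
      have hr' : (r0 : ℝ) ≤ r := by exact_mod_cast hr0r
      have hy' : (0 : ℝ) ≤ y := by exact_mod_cast hy
      calc _ ≤ (a * (r0 : ℝ) - l * r0) / (a - l) := by gcongr
        _ = r0 := by field_simp
        _ ≤ r := hr'
        _ ≤ _ := by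
          have : 0 ≤ l * b / (a - l) * y := by positivity
          linarith

lemma beta_mono : Monotone beta := by
  apply monotone_nat_of_le_succ
  intro n
  cases n with
  | zero => simp [beta]
  | succ n => simp only [beta]; omega

lemma inj_plus {b e : ℝ} (hb : 0 < b) (he : 0 < e) :
    Set.InjOn (fun l : ℝ => l * b / (l + e)) {l | 0 < l} := by
  intro l hl l' hl' h
  simp only [Set.mem_ofPred_eq] at hl hl' h
  rw [div_eq_div_iff (by positivity) (by positivity)] at h
  have : (b * e) * (l - l') = 0 := by linear_combination h
  rcases mul_eq_zero.mp this with h | h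
  · exact absurd h (by positivity)
  · linarith

lemma inj_minus {a b : ℝ} (hb : 0 < b) (ha : 0 < a) :
    Set.InjOn (fun l : ℝ => l * b / (a - l)) {l | l < a} := by
  intro l hl l' hl' h
  simp only [Set.mem_ofPred_eq] at hl hl' h
  rw [div_eq_div_iff (by linarith) (by linarith)] at h
  have : (b * a) * (l - l') = 0 := by linear_combination h
  rcases mul_eq_zero.mp this with h | h
  · exact absurd h (by positivity)
  · linarith

lemma claimC (n : ℕ) : ∀ a b r0 : ℤ, b ≤ n → 0 ≤ a → a < b → 0 ≤ r0 → r0 < b →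
    ∀ F : Finset ℝ, (∀ l ∈ F, Edg a b r0 l) →
    (beta (F.card + 1) : ℤ) ≤ b ∧ (beta F.card : ℤ) ≤ a ∧ (beta F.card : ℤ) ≤ b - a := by
  induction n with
  | zero => intro a b r0 h1 h2 h3; exfalso; simp at h1; omega
  | succ n ih =>
  intro a b r0 hbn ha hab hr0 hrb F hF
  push_cast at hbn
  rcases Nat.eq_zero_or_pos F.card with hm | hm
  · rw [hm]; simp [beta]; omega
  obtain ⟨k, hk⟩ : ∃ k, F.card = k + 1 := ⟨F.card - 1, by omega⟩
  have hbR : (0 : ℝ) < b := by exact_mod_cast (by omega : 0 < b)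
  have hFpos : ∀ l ∈ F, 0 < l := fun l hl => (hF l hl).1
  rcases ha.eq_or_lt with ha0 | ha0
  · exfalso
    subst ha0
    obtain ⟨l, hl⟩ := Finset.card_pos.mp hm
    obtain ⟨hl, x1, r1, x2, r2, h1, h2, h12, heq, hmin⟩ := hF l hl
    have h0 := hmin 0 r0 ⟨le_rfl, hr0, by simp⟩
    have hr2 : r0 ≤ r2 := by
      obtain ⟨_, hr, y, hy⟩ := h2
      by_contra hc
      have : y < 0 := by
        by_contra hy0
        nlinarith [mul_nonneg (by omega : 0 ≤ b) (not_lt.mp hy0)]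
      nlinarith [mul_nonneg (by omega : 0 ≤ b) (by omega : 0 ≤ -y - 1)]
    have h3 : (r0 : ℝ) < r1 := by exact_mod_cast (by omega : r0 < r1)
    have hx1 : (0 : ℝ) ≤ x1 := by exact_mod_cast h1.1
    have := mul_nonneg hl.le hx1
    simp at h0
    linarith
  -- reduction R as a general counting statement
  have red : ∀ a b r0 : ℤ, b ≤ n + 1 → 0 < a → a < b → 0 ≤ r0 → r0 < b - a → ∀ F : Finset ℝ,
      (∀ l ∈ F, Edg a b r0 l) →
      (beta (F.card + 1) : ℤ) ≤ b - a ∧ (beta F.card : ℤ) ≤ a % (b - a) := by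
    intro a b r0 hbn ha hab hr0 hre F hF
    have hbR : (0 : ℝ) < b := by exact_mod_cast (by omega : 0 < b)
    have heR : (0 : ℝ) < ((b - a : ℤ) : ℝ) := by exact_mod_cast (by omega : 0 < b - a)
    have hc : (F.image (fun l : ℝ => l * b / (l + ((b - a : ℤ) : ℝ)))).card = F.card :=
      Finset.card_image_of_injOn ((inj_plus hbR heR).mono (fun l hl => (hF l hl).1))
    have := ih (a % (b - a)) (b - a) (r0 % (b - a)) (by omega)
      (Int.emod_nonneg _ (by omega)) (Int.emod_lt_of_pos _ (by omega))
      (Int.emod_nonneg _ (by omega)) (Int.emod_lt_of_pos _ (by omega))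
      (F.image (fun l : ℝ => l * b / (l + ((b - a : ℤ) : ℝ)))) (by
        intro l' hl'
        obtain ⟨l, hl, rfl⟩ := Finset.mem_image.mp hl'
        exact Edg_mod (transR (by omega) ha.le (by ring) hr0 hre (hF l hl)))
    rw [hc] at this
    exact ⟨this.1, this.2.1⟩
  have hmono : (beta F.card : ℤ) ≤ beta (F.card + 1) := by
    exact_mod_cast beta_mono (Nat.le_succ _)
  by_cases c2 : r0 < b - a
  · obtain ⟨h1, h2⟩ := red a b r0 (by exact_mod_cast hbn) ha0 hab hr0 c2 F hF
    have h3 : a % (b - a) ≤ a := by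
      rw [Int.emod_def]
      have : 0 ≤ (b - a) * (a / (b - a)) :=
        mul_nonneg (by omega) (Int.ediv_nonneg ha (by omega))
      omega
    refine ⟨by omega, by omega, by omega⟩
  have hbk : (beta (F.card + 1) : ℤ) = 2 * beta (k + 1) + beta k := by
    rw [hk]; simp [beta]
  by_cases c3 : r0 < a
  · set e := b - a with hedef
    have heR : (0 : ℝ) < (e : ℝ) := by exact_mod_cast (by omega : 0 < e)
    classical
    set Q : ℝ → Prop := fun l => ((∃ x r : ℤ, InS a b r0 x r ∧ r < r0 ∧ l * x + r = r0) ∧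
        ∀ x r : ℤ, InS a b r0 x r → r0 ≤ l * x + r) with hQ
    set G := F.filter (fun l => ¬ Q l) with hG
    have hone : (F.filter Q).card ≤ 1 := by
      rw [Finset.card_le_one]
      have main : ∀ l l' : ℝ, Q l → Q l' → l ≤ l' := by
        rintro l l' ⟨⟨x, r, hx, hr, he⟩, _⟩ ⟨_, hm⟩
        have := hm x r hx
        have hx0 : 0 < x := by
          rcases hx.1.eq_or_lt with h | h
          · exfalso
            rw [← h] at he
            simp at he
            omega
          · exact h
        have hx0 : (0 : ℝ) < x := by exact_mod_cast hx0
        by_contra hc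
        nlinarith
      intro l hl l' hl'
      rw [Finset.mem_filter] at hl hl'
      exact le_antisymm (main _ _ hl.2 hl'.2) (main _ _ hl'.2 hl.2)
    have hcard : k ≤ G.card := by
      have : (F.filter Q).card + G.card = F.card := by
        rw [hG]
        convert Finset.card_filter_add_card_filter_not (s := F) Q
      omega
    have hc : (G.image (fun l : ℝ => l * b / (l + (e : ℝ)))).card = G.card :=
      Finset.card_image_of_injOn ((inj_plus hbR heR).mono
        (fun l hl => (hF l (Finset.mem_filter.mp hl).1).1))
    have := ih (a % e) e ((r0 - b) % e) (by omega)
      (Int.emod_nonneg _ (by omega)) (Int.emod_lt_of_pos _ (by omega))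
      (Int.emod_nonneg _ (by omega)) (Int.emod_lt_of_pos _ (by omega))
      (G.image (fun l : ℝ => l * b / (l + (e : ℝ)))) (by
        intro l' hl'
        obtain ⟨l, hl, rfl⟩ := Finset.mem_image.mp hl'
        have hl := Finset.mem_filter.mp hl
        exact Edg_mod ((trans3 (by omega) ha (by omega) hr0 hrb (hF l hl.1)).resolve_right hl.2))
    rw [hc] at this
    have m1 : (beta (k + 1) : ℤ) ≤ beta (G.card + 1) := by
      exact_mod_cast beta_mono (by omega)
    have m2 : (beta k : ℤ) ≤ beta G.card := by
      exact_mod_cast beta_mono (by omega)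
    have h3 : a % e + e ≤ a := by
      have h1 := Int.emod_add_mul_ediv a e
      have : 1 ≤ a / e := by
        rw [Int.le_ediv_iff_mul_le (by omega)]; omega
      nlinarith
    rw [hbk, hk]
    refine ⟨by omega, by omega, by omega⟩
  · have haR : (0 : ℝ) < a := by exact_mod_cast ha0
    set G := F.erase (a : ℝ) with hG
    have hGk : k ≤ G.card := by
      have : F.card - 1 ≤ G.card := Finset.pred_card_le_card_erase
      omega
    have hGF : ∀ l ∈ G, l < a ∧ Edg (-b) a r0 (l * b / (a - l)) := by
      intro l hl
      have hl := Finset.mem_erase.mp hl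
      exact trans1 ha0 hr0 hrb (hF l hl.2) hl.1
    have hc : (G.image (fun l : ℝ => l * b / (a - l))).card = G.card :=
      Finset.card_image_of_injOn ((inj_minus hbR haR).mono (fun l hl => (hGF l hl).1))
    have hG2 : ∀ l ∈ G.image (fun l : ℝ => l * b / (a - l)), Edg ((-b) % a) a (r0 % a) l := by
      intro l' hl'
      obtain ⟨l, hl, rfl⟩ := Finset.mem_image.mp hl'
      exact Edg_mod (hGF l hl).2
    set a' := (-b) % a with ha'
    have ha'0 : 0 ≤ a' := Int.emod_nonneg _ (by omega)
    have ha'a : a' < a := Int.emod_lt_of_pos _ (by omega)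
    obtain ⟨j, hj⟩ : ∃ j, b + a' = a * j := by
      have := Int.emod_add_mul_ediv (-b) a
      exact ⟨-((-b) / a), by rw [ha']; linarith⟩
    have hj2 : 2 ≤ j := by
      by_contra hc
      nlinarith [mul_nonneg ha0.le (by omega : 0 ≤ 1 - j)]
    have m1 : (beta (k + 1) : ℤ) ≤ beta (G.card + 1) := by
      exact_mod_cast beta_mono (by omega)
    have m2 : (beta k : ℤ) ≤ beta G.card := by
      exact_mod_cast beta_mono (by omega)
    have ihh := ih a' a (r0 % a) (by omega) ha'0 ha'a (Int.emod_nonneg _ (by omega))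
      (Int.emod_lt_of_pos _ (by omega)) _ hG2
    rw [hc] at ihh
    rw [hbk, hk]
    rcases hj2.eq_or_lt with h2 | h2
    · subst h2
      rcases ha'0.eq_or_lt with h0 | h0
      · refine ⟨by omega, by omega, by omega⟩
      have hr1 : r0 % a < a - a' := by
        have h1 := Int.emod_add_mul_ediv r0 a
        have : 1 ≤ r0 / a := by
          rw [Int.le_ediv_iff_mul_le (by omega)]; omega
        nlinarith
      have := red a' a (r0 % a) (by omega) h0 ha'a (Int.emod_nonneg _ (by omega)) hr1 _ hG2
      rw [hc] at this
      have h3 : a' % (a - a') ≤ a' := by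
        rw [Int.emod_def]
        have : 0 ≤ (a - a') * (a' / (a - a')) :=
          mul_nonneg (by omega) (Int.ediv_nonneg ha'0 (by omega))
        omega
      refine ⟨by omega, by omega, by omega⟩
    · have : a * 3 ≤ a * j := by nlinarith
      refine ⟨by omega, by omega, by omega⟩

def InT (a b c x y : ℤ) : Prop := 0 ≤ x ∧ 0 ≤ y ∧ a * x + b * y ≤ c

def UpV (a b c : ℤ) (v : ℤ × ℤ) : Prop :=
  InT a b c v.1 v.2 ∧ ∃ l : ℝ, 0 < l ∧ ∀ x y : ℤ, InT a b c x y → (x, y) ≠ v →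
    (l - a) * v.1 - b * v.2 < (l - a) * x - b * y

lemma edgT {a b c : ℤ} (ha : 0 < a) (hb : 0 < b) {l : ℝ} (hl : 0 < l) {x1 y1 x2 y2 : ℤ}
    (h1 : InT a b c x1 y1) (h2 : InT a b c x2 y2) (h12 : x1 < x2)
    (heq : (l - a) * x1 - b * y1 = (l - a) * x2 - b * y2)
    (hmin : ∀ x y : ℤ, InT a b c x y → (l - a) * x2 - b * y2 ≤ (l - a) * x - b * y) :
    Edg a b c l := by
  have haR : (0 : ℝ) < a := by exact_mod_cast ha
  have hbR : (0 : ℝ) < b := by exact_mod_cast hb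
  have h12R : (x1 : ℝ) < x2 := by exact_mod_cast h12
  have h1x := h1.1
  have h1y := h1.2.1
  have h2y := h2.2.1
  have h2c := h2.2.2
  have hla : l ≤ a := by
    have := hmin (x2 - 1) y2 ⟨by omega, h2y, by nlinarith⟩
    push_cast at this
    nlinarith
  have hr : (c - a * x2 - b * y2 : ℤ) < c - a * x1 - b * y1 := by
    have : ((c - a * x2 - b * y2 : ℤ) : ℝ) < ((c - a * x1 - b * y1 : ℤ) : ℝ) := by
      push_cast
      nlinarith [mul_pos hl (sub_pos.mpr h12R)]
    exact_mod_cast this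
  have hyy : y2 ≤ y1 := by
    have : (y2 : ℝ) ≤ y1 := by
      by_contra hc
      nlinarith [mul_pos hbR (sub_pos.mpr (not_le.mp hc)),
        mul_nonneg (sub_nonneg.mpr hla) (sub_nonneg.mpr h12R.le)]
    exact_mod_cast this
  refine ⟨hl, x1, c - a * x1 - b * y1, x2, c - a * x2 - b * y2,
    ⟨h1.1, by linarith [h1.2.2], -y1, by ring⟩, ⟨h2.1, by linarith [h2.2.2], -y2, by ring⟩,
    hr, by push_cast; linear_combination heq, ?_⟩
  rintro x r ⟨hx, hr0, y', hy'⟩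
  obtain ⟨y, rfl⟩ : ∃ y, y' = -y := ⟨-y', by ring⟩
  have hrr : r = c - a * x - b * y := by linear_combination hy'
  subst hrr
  have hgoal : (l - a) * x1 - b * y1 ≤ (l - a) * x - b * y := by
    rw [heq]
    by_cases hy0 : 0 ≤ y
    · exact hmin x y ⟨hx, hy0, by linarith⟩
    rcases hyy.eq_or_lt with h0 | h0
    · have hla' : l = a := by
        subst h0
        have : (l - a) * ((x2 : ℝ) - x1) = 0 := by linear_combination -heq
        rcases mul_eq_zero.mp this with h | h
        · linarith
        · linarith
      rw [hla']
      have : (y : ℝ) ≤ y2 := by exact_mod_cast (by omega)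
      nlinarith
    · by_contra hcon
      rw [not_le] at hcon
      set D := y1 - y2 with hD
      have hDp : 0 < D := by omega
      set k := -(y / D) with hk
      have hk0 : 0 ≤ k := by
        have : y / D < 0 := Int.ediv_neg_of_neg_of_pos (by omega) hDp
        omega
      have hmodeq : y + k * D = y % D := by
        rw [Int.emod_def, hk]; ring
      have hm0 : 0 ≤ y % D := Int.emod_nonneg _ (by omega)
      have hm1 : y % D < D := Int.emod_lt_of_pos _ hDp
      have hkR : (0 : ℝ) ≤ k := by exact_mod_cast hk0
      have hval : (l - a) * ((x + k * (x1 - x2) : ℤ) : ℝ) - b * ((y % D : ℤ) : ℝ)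
          = (l - a) * x - b * y := by
        rw [← hmodeq, hD]; push_cast; linear_combination k * heq
      have hylt : ((y % D : ℤ) : ℝ) < y1 := by exact_mod_cast (by omega)
      have hx' : (x1 : ℝ) < ((x + k * (x1 - x2) : ℤ) : ℝ) := by
        by_contra hc
        rw [not_lt] at hc
        nlinarith [mul_nonneg (sub_nonneg.mpr hla) (sub_nonneg.mpr hc),
          mul_pos hbR (sub_pos.mpr hylt)]
      have hx'' : x1 < x + k * (x1 - x2) := by exact_mod_cast hx'
      have := hmin (x + k * (x1 - x2)) (y % D) ⟨by omega, hm0, by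
        rw [← hmodeq, hD]
        nlinarith [mul_nonneg hk0 (by linarith : 0 ≤ a * (x2 - x1) - b * (y1 - y2))]⟩
      linarith
  push_cast
  linarith

lemma upV_edge {a b c : ℤ} (ha : 0 < a) (hb : 0 < b) (hc : 0 ≤ c) {v : ℤ × ℤ}
    (hv : UpV a b c v) (hne : v ≠ (0, c / b)) :
    ∃ l : ℝ, Edg a b c l ∧
      (∀ x y : ℤ, InT a b c x y → (l - a) * v.1 - b * v.2 ≤ (l - a) * x - b * y) ∧
      ∃ l' < l, ∀ x y : ℤ, InT a b c x y → (x, y) ≠ v →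
        (l' - a) * v.1 - b * v.2 < (l' - a) * x - b * y := by
  obtain ⟨⟨hx, hy, hxy⟩, l, hl, hmin⟩ := hv
  obtain ⟨xv, yv⟩ := v
  simp only at *
  have hbR : (0 : ℝ) < b := by exact_mod_cast hb
  have hv0 : InT a b c 0 (c / b) := ⟨le_rfl, Int.ediv_nonneg hc hb.le, by
    have := Int.mul_ediv_self_le (x := c) (k := b) (by omega)
    linarith⟩
  have hxp : 0 < xv := by
    rcases hx.eq_or_lt with h | h
    · exfalso
      subst h
      have h1 := hmin 0 (c / b) hv0 (fun h => hne h.symm)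
      have h2 : ((c / b : ℤ) : ℝ) < yv := by
        push_cast at h1 ⊢
        nlinarith
      have h2 : c / b < yv := by exact_mod_cast h2
      have : yv ≤ c / b := by
        rw [Int.le_ediv_iff_mul_le hb]; linarith
      omega
    · exact h
  classical
  set S := ((Finset.Icc (0:ℤ) c) ×ˢ (Finset.Icc (0:ℤ) c)).filter
    (fun p => InT a b c p.1 p.2 ∧ p.1 < xv) with hS
  have memS : ∀ x y : ℤ, InT a b c x y → x < xv → (x, y) ∈ S := by
    intro x y h hlt
    obtain ⟨h1, h2, h3⟩ := h
    rw [hS, Finset.mem_filter, Finset.mem_product, Finset.mem_Icc, Finset.mem_Icc]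
    refine ⟨⟨⟨h1, ?_⟩, h2, ?_⟩, ⟨h1, h2, h3⟩, hlt⟩
    · nlinarith [mul_nonneg hb.le h2]
    · nlinarith [mul_nonneg ha.le h1]
  obtain ⟨⟨X, Y⟩, hV, hVmin⟩ := Finset.exists_min_image S
    (fun p => (a : ℝ) - b * ((p.2 : ℝ) - yv) / ((xv : ℝ) - p.1)) ⟨_, memS _ _ hv0 hxp⟩
  rw [hS, Finset.mem_filter] at hV
  obtain ⟨-, hVT, hVx⟩ := hV
  simp only at *
  have hVxR : (0 : ℝ) < xv - X := sub_pos.mpr (by exact_mod_cast hVx)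
  set L := (a : ℝ) - b * ((Y : ℝ) - yv) / ((xv : ℝ) - X) with hL
  have hLeq : (L - a) * X - b * Y = (L - a) * xv - b * yv := by
    have : L * (xv - X) = a * (xv - X) - b * (Y - yv) := by
      rw [hL]; field_simp
    linear_combination -this
  have hlL : l < L := by
    have := hmin X Y hVT (by intro h; simp only [Prod.mk.injEq] at h; omega)
    by_contra hcon
    nlinarith [mul_nonneg (sub_nonneg.mpr (not_lt.mp hcon)) hVxR.le]
  have hLmin : ∀ x y : ℤ, InT a b c x y → (L - a) * xv - b * yv ≤ (L - a) * x - b * y := by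
    intro x y h
    by_cases hlt : x < xv
    · have h1 := hVmin (x, y) (memS x y h hlt)
      simp only at h1
      have h2 : (0 : ℝ) < xv - x := sub_pos.mpr (by exact_mod_cast hlt)
      have h3 : b * ((y : ℝ) - yv) / ((xv : ℝ) - x) ≤ a - L := by linarith
      rw [div_le_iff₀ h2] at h3
      linarith
    · have hle : (xv : ℝ) ≤ x := by exact_mod_cast not_lt.mp hlt
      by_cases he : (x, y) = (xv, yv)
      · simp only [Prod.mk.injEq] at he
        rw [he.1, he.2]
      · have := hmin x y h he
        nlinarith [mul_nonneg (sub_nonneg.mpr hlL.le) (sub_nonneg.mpr hle)]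
  exact ⟨L, edgT ha hb (hl.trans hlL) hVT ⟨hx, hy, hxy⟩ hVx hLeq hLmin, hLmin, l, hlL, hmin⟩

lemma upV_bound {a b c : ℤ} (ha : 0 < a) (hb : 0 < b) (hc : 0 ≤ c) (F : Finset (ℤ × ℤ))
    (hF : ∀ v ∈ F, UpV a b c v) :
    (beta F.card : ℤ) ≤ b ∧ (beta (F.card - 1) : ℤ) ≤ a % b := by
  classical
  have hbR : (0 : ℝ) < b := by exact_mod_cast hb
  set G := F.erase (0, c / b) with hG
  have h1 : ∀ v ∈ G, ∃ l : ℝ, Edg a b c l ∧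
      (∀ x y : ℤ, InT a b c x y → (l - a) * v.1 - b * v.2 ≤ (l - a) * x - b * y) ∧
      ∃ l' < l, ∀ x y : ℤ, InT a b c x y → (x, y) ≠ v →
        (l' - a) * v.1 - b * v.2 < (l' - a) * x - b * y := by
    intro v hv
    have hv := Finset.mem_erase.mp hv
    exact upV_edge ha hb hc (hF v hv.2) hv.1
  choose! L hL1 hL2 hL3 using h1
  have hinj : Set.InjOn L G := by
    have main : ∀ v ∈ G, ∀ w ∈ G, L v = L w → v ≠ w → (w.1 : ℝ) < v.1 := by
      intro v hv w hw h hne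
      obtain ⟨l', hl', hm⟩ := hL3 v hv
      have hvT := (hF v (Finset.mem_erase.mp hv).2).1
      have hwT := (hF w (Finset.mem_erase.mp hw).2).1
      have e1 := hm w.1 w.2 hwT (fun h => hne h.symm)
      have e2 := hL2 w hw v.1 v.2 hvT
      rw [← h] at e2
      by_contra hcon
      nlinarith [mul_nonneg (sub_nonneg.mpr hl'.le) (sub_nonneg.mpr (not_lt.mp hcon))]
    intro v hv w hw h
    by_contra hne
    have := main v hv w hw h hne
    have := main w hw v hv h.symm (Ne.symm hne)
    linarith
  have hcI : (G.image L).card = G.card := Finset.card_image_of_injOn hinj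
  have hGc : F.card - 1 ≤ G.card := Finset.pred_card_le_card_erase
  have := claimC b.toNat (a % b) b (c % b) (by omega) (Int.emod_nonneg _ (by omega))
    (Int.emod_lt_of_pos _ hb) (Int.emod_nonneg _ (by omega)) (Int.emod_lt_of_pos _ hb)
    (G.image L) (by
      intro l hl
      obtain ⟨v, hv, rfl⟩ := Finset.mem_image.mp hl
      exact Edg_mod (hL1 v hv))
  rw [hcI] at this
  have m1 : (beta F.card : ℤ) ≤ beta (G.card + 1) := by
    exact_mod_cast beta_mono (by omega)
  have m2 : (beta (F.card - 1) : ℤ) ≤ beta G.card := by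
    exact_mod_cast beta_mono (by omega)
  exact ⟨by omega, by omega⟩

def kT (a b c : ℕ) : Set (ℝ × ℝ) :=
  {p : ℝ × ℝ | (∃ x : ℤ, p.1 = (x : ℝ)) ∧ (∃ y : ℤ, p.2 = (y : ℝ)) ∧
      0 ≤ p.1 ∧ 0 ≤ p.2 ∧ (a : ℝ) * p.1 + (b : ℝ) * p.2 ≤ (c : ℝ)}

lemma tkv_eq (a b c : ℕ) : twoKnapVert a b c = Set.extremePoints ℝ (convexHull ℝ (kT a b c)) := rfl

def emb (v : ℤ × ℤ) : ℝ × ℝ := ((v.1 : ℝ), (v.2 : ℝ))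

lemma emb_inj : Function.Injective emb := by
  rintro ⟨x, y⟩ ⟨x', y'⟩ h
  simpa [emb, Prod.ext_iff] using h

lemma mem_kT {a b c : ℕ} {p : ℝ × ℝ} : p ∈ kT a b c ↔ ∃ v : ℤ × ℤ, emb v = p ∧ InT a b c v.1 v.2 := by
  constructor
  · rintro ⟨⟨x, hx⟩, ⟨y, hy⟩, h0, h1, h2⟩
    refine ⟨(x, y), Prod.ext hx.symm hy.symm, ?_, ?_, ?_⟩
    · rw [hx] at h0; exact_mod_cast h0
    · rw [hy] at h1; exact_mod_cast h1
    · rw [hx, hy] at h2; exact_mod_cast h2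
  · rintro ⟨v, rfl, h0, h1, h2⟩
    refine ⟨⟨v.1, rfl⟩, ⟨v.2, rfl⟩, ?_, ?_, ?_⟩
    · simpa [emb] using h0
    · simpa [emb] using h1
    · simp only [emb]; exact_mod_cast h2

lemma kT_finite {a b c : ℕ} (ha : 0 < a) (hb : 0 < b) : (kT a b c).Finite := by
  have h1 : (Set.Icc (0 : ℤ) c ×ˢ Set.Icc (0 : ℤ) c).Finite :=
    (Set.finite_Icc _ _).prod (Set.finite_Icc _ _)
  refine (h1.image emb).subset ?_
  intro p hp
  obtain ⟨v, rfl, h0, h1, h2⟩ := mem_kT.1 hp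
  refine ⟨v, ⟨⟨h0, ?_⟩, ⟨h1, ?_⟩⟩, rfl⟩
  · have : (1 : ℤ) ≤ a := by exact_mod_cast ha
    nlinarith [mul_nonneg (by omega : (0:ℤ) ≤ a - 1) h0, mul_nonneg (by omega : (0:ℤ) ≤ b) h1]
  · have : (1 : ℤ) ≤ b := by exact_mod_cast hb
    nlinarith [mul_nonneg (by omega : (0:ℤ) ≤ b - 1) h1, mul_nonneg (by omega : (0:ℤ) ≤ a) h0]

lemma ext_functional {T : Set (ℝ × ℝ)} (hT : T.Finite) {p : ℝ × ℝ}
    (hp : p ∈ Set.extremePoints ℝ (convexHull ℝ T)) :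
    ∃ α β : ℝ, ∀ q ∈ T, q ≠ p → α * q.1 + β * q.2 < α * p.1 + β * p.2 := by
  rw [(convex_convexHull ℝ T).mem_extremePoints_iff_mem_sdiff_convexHull_sdiff] at hp
  have h1 : p ∉ convexHull ℝ (T \ {p}) := fun h =>
    hp.2 (convexHull_mono (Set.sdiff_subset_sdiff_left (subset_convexHull ℝ T)) h)
  have hcl : IsClosed (convexHull ℝ (T \ {p})) := (hT.subset Set.sdiff_subset).isClosed_convexHull ℝ
  obtain ⟨f, u, hf, hu⟩ := geometric_hahn_banach_closed_point (convex_convexHull ℝ _) hcl h1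
  have key : ∀ q : ℝ × ℝ, f q = f (1, 0) * q.1 + f (0, 1) * q.2 := by
    intro q
    have : q = q.1 • ((1 : ℝ), (0 : ℝ)) + q.2 • ((0 : ℝ), (1 : ℝ)) := by ext <;> simp
    conv_lhs => rw [this, map_add, map_smul, map_smul]
    simp [mul_comm]
  refine ⟨f (1, 0), f (0, 1), fun q hq hne => ?_⟩
  rw [← key, ← key]
  exact (hf q (subset_convexHull ℝ _ ⟨hq, hne⟩)).trans hu

lemma ext_of_functional {T : Set (ℝ × ℝ)} {p : ℝ × ℝ} (hp : p ∈ T) (α β : ℝ)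
    (h : ∀ q ∈ T, q ≠ p → α * q.1 + β * q.2 < α * p.1 + β * p.2) :
    p ∈ Set.extremePoints ℝ (convexHull ℝ T) := by
  have hconv : Convex ℝ ({q : ℝ × ℝ | α * q.1 + β * q.2 < α * p.1 + β * p.2} ∪ {p}) := by
    intro x hx y hy s t hs ht hst
    by_cases hxy : x = p ∧ y = p
    · right
      rw [hxy.1, hxy.2, ← add_smul, hst, one_smul]; rfl
    · rcases hs.eq_or_lt with rfl | hs
      · have : t = 1 := by linarith
        subst this; simpa using hy
      rcases ht.eq_or_lt with rfl | ht
      · have : s = 1 := by linarith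
        subst this; simpa using hx
      left
      have hx' : α * x.1 + β * x.2 ≤ α * p.1 + β * p.2 := by
        rcases hx with hx | hx
        · exact le_of_lt hx
        · rw [hx]
      have hy' : α * y.1 + β * y.2 ≤ α * p.1 + β * p.2 := by
        rcases hy with hx | hx
        · exact le_of_lt hx
        · rw [hx]
      have hs1 : s = 1 - t := by linarith
      show α * (s • x + t • y).1 + β * (s • x + t • y).2 < _
      simp only [Prod.fst_add, Prod.snd_add, Prod.smul_fst, Prod.smul_snd, smul_eq_mul]
      have e : α * (s * x.1 + t * y.1) + β * (s * x.2 + t * y.2)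
        = s * (α * x.1 + β * x.2) + t * (α * y.1 + β * y.2) := by ring
      rw [e]
      have e2 : α * p.1 + β * p.2 = s * (α * p.1 + β * p.2) + t * (α * p.1 + β * p.2) := by
        rw [← add_mul, hst, one_mul]
      rw [e2]
      by_cases hx2 : x = p
      · have hy2 : y ≠ p := fun hh => hxy ⟨hx2, hh⟩
        have : α * y.1 + β * y.2 < α * p.1 + β * p.2 := by
          rcases hy with hx | hx
          · exact hx
          · exact absurd hx hy2
        have := mul_lt_mul_of_pos_left this ht
        have := mul_le_mul_of_nonneg_left hx' hs.le
        linarith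
      · have : α * x.1 + β * x.2 < α * p.1 + β * p.2 := by
          rcases hx with hx | hx
          · exact hx
          · exact absurd hx hx2
        have := mul_lt_mul_of_pos_left this hs
        have := mul_le_mul_of_nonneg_left hy' ht.le
        linarith
  have hsub : convexHull ℝ T ⊆ ({q : ℝ × ℝ | α * q.1 + β * q.2 < α * p.1 + β * p.2} ∪ {p}) := by
    refine convexHull_min (fun q hq => ?_) hconv
    by_cases hqp : q = p
    · right; exact hqp
    · left; exact h q hq hqp
  rw [(convex_convexHull ℝ T).mem_extremePoints_iff_mem_sdiff_convexHull_sdiff]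
  refine ⟨subset_convexHull ℝ T hp, fun hmem => ?_⟩
  have hhalf : Convex ℝ {q : ℝ × ℝ | α * q.1 + β * q.2 < α * p.1 + β * p.2} := by
    have : IsLinearMap ℝ (fun q : ℝ × ℝ => α * q.1 + β * q.2) := by
      constructor
      · intro x y; simp; ring
      · intro r x; simp; ring
    exact convex_halfSpace_lt this _
  have : convexHull ℝ (convexHull ℝ T \ {p}) ⊆ {q : ℝ × ℝ | α * q.1 + β * q.2 < α * p.1 + β * p.2} := by
    refine convexHull_min (fun q hq => ?_) hhalf
    rcases hsub hq.1 with h | h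
    · exact h
    · exact absurd h hq.2
  have h9 : α * p.1 + β * p.2 < α * p.1 + β * p.2 := this hmem
  exact lt_irrefl _ h9

lemma upV_of_functional {a b c : ℤ} (ha : 0 < a) (hb : 0 < b) {v : ℤ × ℤ}
    (hv : InT a b c v.1 v.2) {α β : ℝ} (hβ : 0 < β) (hab : α * b ≤ β * a)
    (h : ∀ x y : ℤ, InT a b c x y → (x, y) ≠ v → α * x + β * y < α * v.1 + β * v.2) :
    UpV a b c v := by
  have hbR : (0 : ℝ) < b := by exact_mod_cast hb
  refine ⟨hv, ?_⟩
  rcases hab.lt_or_eq with hlt | heq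
  · refine ⟨(β * a - α * b) / β, div_pos (by linarith) hβ, fun x y hxy hne => ?_⟩
    have h1 := h x y hxy hne
    have e : (β * a - α * b) / β - a = - (b / β) * α := by field_simp; ring
    rw [e]
    have h2 := mul_lt_mul_of_pos_left h1 (div_pos hbR hβ)
    have e3 : ∀ u w : ℝ, -(b / β) * α * u - b * w = - (b / β * (α * u + β * w)) := by
      intro u w; field_simp; ring
    rw [e3, e3]; linarith
  · have hc : 0 ≤ c := by
      have := hv.2.2
      nlinarith [mul_nonneg ha.le hv.1, mul_nonneg hb.le hv.2.1]
    have hcR : (0 : ℝ) < c + 1 := by exact_mod_cast (by omega : 0 < c + 1)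
    refine ⟨1 / (c + 1), by positivity, fun x y hxy hne => ?_⟩
    have h1 := h x y hxy hne
    -- a x + b y < a v1 + b v2
    have h2 : (a : ℝ) * x + b * y < a * v.1 + b * v.2 := by
      have h2 := mul_lt_mul_of_pos_left h1 hbR
      have : β * (a * x + b * y) < β * (a * v.1 + b * v.2) := by
        have e1 : β * (a * x + b * y) = b * (α * x + β * y) := by linear_combination -x * heq
        have e2 : β * (a * v.1 + b * v.2) = b * (α * v.1 + β * v.2) := by
          linear_combination -v.1 * heq
        rw [e1, e2]; exact h2
      exact lt_of_mul_lt_mul_left this hβ.le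
    have h3 : a * x + b * y + 1 ≤ a * v.1 + b * v.2 := by
      have : a * x + b * y < a * v.1 + b * v.2 := by exact_mod_cast h2
      omega
    have hv1 : v.1 ≤ c := by
      have := hv.2.2
      nlinarith [mul_nonneg (by omega : 0 ≤ a - 1) hv.1, mul_nonneg hb.le hv.2.1]
    have h3R : (a : ℝ) * x + b * y + 1 ≤ a * v.1 + b * v.2 := by exact_mod_cast h3
    have hv1R : (v.1 : ℝ) ≤ c := by exact_mod_cast hv1
    have hx0 : (0 : ℝ) ≤ x := by exact_mod_cast hxy.1
    have h4 : 1 / ((c : ℝ) + 1) * v.1 < 1 := by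
      rw [div_mul_eq_mul_div, div_lt_one hcR]; linarith
    have h5 : 0 ≤ 1 / ((c : ℝ) + 1) * x := by positivity
    linarith

lemma InT_swap {a b c x y : ℤ} (h : InT a b c x y) : InT b a c y x :=
  ⟨h.2.1, h.1, by linarith [h.2.2]⟩

lemma vert_class {a b c : ℕ} (ha : 0 < a) (hb : 0 < b) {p : ℝ × ℝ} (hp : p ∈ twoKnapVert a b c) :
    ∃ v : ℤ × ℤ, emb v = p ∧ (v = (0, 0) ∨ UpV a b c v ∨ UpV b a c v.swap) := by
  rw [tkv_eq] at hp
  obtain ⟨v, rfl, hv⟩ := mem_kT.1 (extremePoints_convexHull_subset hp)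
  obtain ⟨α, β, h⟩ := ext_functional (kT_finite ha hb) hp
  have h' : ∀ x y : ℤ, InT a b c x y → (x, y) ≠ v → α * x + β * y < α * v.1 + β * v.2 := by
    intro x y hxy hne
    exact h (emb (x, y)) (mem_kT.2 ⟨(x, y), rfl, hxy⟩) (fun hh => hne (emb_inj hh))
  refine ⟨v, rfl, ?_⟩
  have haR : (0 : ℝ) < a := by exact_mod_cast ha
  have hbR : (0 : ℝ) < b := by exact_mod_cast hb
  have haZ : (0 : ℤ) < a := by exact_mod_cast ha
  have hbZ : (0 : ℤ) < b := by exact_mod_cast hb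
  by_cases h00 : α ≤ 0 ∧ β ≤ 0
  · left
    by_contra hne
    have h0 : InT a b c 0 0 := ⟨le_rfl, le_rfl, by simp⟩
    have := h' 0 0 h0 (Ne.symm hne)
    have h1 : (0 : ℝ) ≤ v.1 := by exact_mod_cast hv.1
    have h2 : (0 : ℝ) ≤ v.2 := by exact_mod_cast hv.2.1
    simp only [Int.cast_zero] at this
    nlinarith [mul_nonneg (neg_nonneg.2 h00.1) h1, mul_nonneg (neg_nonneg.2 h00.2) h2]
  right
  by_cases hab : α * b ≤ β * a
  · left
    have hβ : 0 < β := by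
      by_contra hβ
      push Not at hβ
      have : 0 < α := by
        by_contra hα; exact h00 ⟨not_lt.1 hα, hβ⟩
      nlinarith [mul_pos this hbR, mul_nonneg (neg_nonneg.2 hβ) haR.le]
    exact upV_of_functional haZ hbZ hv hβ (by simpa using hab) h'
  · right
    push Not at hab
    have hα : 0 < α := by
      by_contra hα
      push Not at hα
      have : 0 < β := by
        by_contra hβ; exact h00 ⟨hα, not_lt.1 hβ⟩
      nlinarith [mul_pos this haR, mul_nonneg (neg_nonneg.2 hα) hbR.le]
    refine upV_of_functional hbZ haZ (v := v.swap) (InT_swap hv) hα (by simpa using hab.le) ?_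
    intro x y hxy hne
    have := h' y x (InT_swap hxy) (by rintro rfl; exact hne rfl)
    simp only [Prod.fst_swap, Prod.snd_swap]
    linarith

lemma vert_bound {a b c : ℕ} (ha : 0 < a) (hab : a ≤ b) :
    ∃ M K : ℕ, (twoKnapVert a b c).ncard ≤ 1 + M + K ∧ beta M ≤ b ∧ beta K + beta (K - 1) ≤ b := by
  classical
  have hb : 0 < b := by omega
  have haZ : (0 : ℤ) < a := by exact_mod_cast ha
  have hbZ : (0 : ℤ) < b := by exact_mod_cast hb
  have hfin : (Set.Icc (0 : ℤ) c ×ˢ Set.Icc (0 : ℤ) c).Finite :=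
    (Set.finite_Icc _ _).prod (Set.finite_Icc _ _)
  have hbox : ∀ a b : ℕ, 0 < a → 0 < b → {v | UpV a b c v}.Finite := by
    intro a b ha hb
    refine hfin.subset ?_
    rintro v ⟨⟨h0, h1, h2⟩, -⟩
    refine ⟨⟨h0, ?_⟩, ⟨h1, ?_⟩⟩
    · nlinarith [mul_nonneg (by omega : (0:ℤ) ≤ a - 1) h0, mul_nonneg (by omega : (0:ℤ) ≤ b) h1]
    · nlinarith [mul_nonneg (by omega : (0:ℤ) ≤ b - 1) h1, mul_nonneg (by omega : (0:ℤ) ≤ a) h0]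
  set U := (hbox a b ha hb).toFinset with hU
  set L := (hbox b a hb ha).toFinset with hL
  have bU := upV_bound (c := c) haZ hbZ (by positivity) U (fun v hv => by simpa [hU] using hv)
  have bL := upV_bound (c := c) hbZ haZ (by positivity) L (fun v hv => by simpa [hL] using hv)
  refine ⟨U.card, L.card, ?_, by exact_mod_cast bU.1, ?_⟩
  · have hsub : twoKnapVert a b c ⊆
        ((({(0, 0)} ∪ U ∪ L.image Prod.swap : Finset (ℤ × ℤ)).image emb : Finset (ℝ × ℝ)) : Set (ℝ × ℝ)) := by
      intro p hp
      obtain ⟨v, rfl, hv⟩ := vert_class ha hb hp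
      rw [Finset.mem_coe]
      refine Finset.mem_image_of_mem _ ?_
      rw [Finset.mem_union, Finset.mem_union]
      rcases hv with rfl | hv | hv
      · left; left; simp
      · left; right; simpa [hU] using hv
      · right
        refine Finset.mem_image.2 ⟨v.swap, by simpa [hL] using hv, by simp⟩
    have h1 := Set.ncard_le_ncard hsub (Finset.finite_toSet _)
    rw [Set.ncard_coe_finset] at h1
    have h2 : (({(0, 0)} ∪ U ∪ L.image Prod.swap : Finset (ℤ × ℤ)).image emb).card
      ≤ ({(0, 0)} ∪ U ∪ L.image Prod.swap : Finset (ℤ × ℤ)).card := Finset.card_image_le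
    have h3 : ({(0, 0)} ∪ U ∪ L.image Prod.swap : Finset (ℤ × ℤ)).card ≤
      ({(0, 0)} ∪ U : Finset (ℤ × ℤ)).card + (L.image Prod.swap).card := Finset.card_union_le _ _
    have h4 : ({(0, 0)} ∪ U : Finset (ℤ × ℤ)).card ≤ ({(0, 0)} : Finset (ℤ × ℤ)).card + U.card :=
      Finset.card_union_le _ _
    have h5 : (L.image Prod.swap).card ≤ L.card := Finset.card_image_le
    have h6 : ({(0, 0)} : Finset (ℤ × ℤ)).card = 1 := Finset.card_singleton _
    omega
  · have h1 : (beta L.card : ℤ) ≤ a := bL.1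
    have h2 : (beta (L.card - 1) : ℤ) ≤ b % a := bL.2
    have h3 : (b : ℤ) % a ≤ b - a := by
      have e : b % a ≤ b - a := by
        rw [Nat.mod_eq_sub_mod hab]; exact Nat.mod_le _ _
      have e2 : ((b % a : ℕ) : ℤ) = (b : ℤ) % a := by push_cast; rfl
      omega
    have : (beta L.card : ℤ) + beta (L.card - 1) ≤ b := by linarith
    exact_mod_cast this

/-- degenerate case -/
lemma vert_zero {b c : ℕ} : (twoKnapVert 0 b c).ncard ≤ 2 ∧ (b = 0 → (twoKnapVert 0 b c).ncard ≤ 1) := by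
  have key : ∀ p ∈ twoKnapVert 0 b c, ∃ y : ℤ, p = emb (0, y) ∧ InT 0 b c 0 y ∧
      ¬ (InT 0 b c 0 (y - 1) ∧ InT 0 b c 0 (y + 1)) := by
    intro p hp
    rw [tkv_eq] at hp
    obtain ⟨⟨x, y⟩, rfl, hv⟩ := mem_kT.1 (extremePoints_convexHull_subset hp)
    have mid : ∀ x' y' : ℤ, InT (0 : ℕ) b c (x - x') (y - y') → InT (0 : ℕ) b c (x + x') (y + y') →
        x' = 0 ∧ y' = 0 := by
      intro x' y' h1 h2
      have m1 := subset_convexHull ℝ _ (mem_kT.2 ⟨(x - x', y - y'), rfl, h1⟩)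
      have m2 := subset_convexHull ℝ _ (mem_kT.2 ⟨(x + x', y + y'), rfl, h2⟩)
      have := hp.2 m1 m2 ⟨1/2, 1/2, by norm_num, by norm_num, by norm_num, by
        ext <;> simp [emb] <;> ring⟩
      have := emb_inj this
      simp only [Prod.mk.injEq] at this
      omega
    have hx : x = 0 := by
      by_contra hx
      obtain ⟨h0, h1, h2⟩ := hv
      simp only at h0 h1 h2
      have := mid 1 0 ⟨by omega, by omega, by simpa using h2⟩ ⟨by omega, by omega, by simpa using h2⟩
      omega
    subst hx
    refine ⟨y, rfl, by simpa using hv, fun hh => ?_⟩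
    have := mid 0 1 (by simpa using hh.1) (by simpa using hh.2)
    omega
  have h1 : twoKnapVert 0 b c ⊆ {emb (0, 0), emb (0, (c : ℤ) / b)} := by
    intro p hp
    obtain ⟨y, rfl, ⟨-, h1, h2⟩, hno⟩ := key p hp
    by_cases hy : y = 0
    · left; rw [hy]
    right
    have hn : ¬ InT 0 b c 0 (y + 1) := by
      intro hh
      refine hno ⟨⟨le_rfl, by omega, ?_⟩, hh⟩
      have : (0 : ℤ) ≤ b := by positivity
      nlinarith
    have h3 : (c : ℤ) < b * (y + 1) := by
      by_contra h
      exact hn ⟨le_rfl, by omega, by linarith⟩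
    have hb : (0 : ℤ) < b := by
      by_contra hb
      have : (b : ℤ) = 0 := by omega
      rw [this] at h3; simp at h3; omega
    have : (c : ℤ) / b = y := by
      rw [Int.ediv_eq_iff_of_pos hb]
      constructor <;> linarith
    rw [this]; rfl
  constructor
  · refine (Set.ncard_le_ncard h1 (by simp)).trans ?_
    exact (Set.ncard_insert_le _ _).trans (by simp)
  · rintro rfl
    refine (Set.ncard_le_ncard h1 (by simp)).trans ?_
    simp

lemma lower_even {s a b c : ℕ} (hs : 1 ≤ s) (hab : a ≤ b) (h : 2 * s ≤ (twoKnapVert a b c).ncard) :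
    beta s ≤ b := by
  rcases Nat.eq_zero_or_pos a with rfl | ha
  · have h1 := (vert_zero (b := b) (c := c)).1
    have h2 := (vert_zero (b := b) (c := c)).2
    have : s = 1 := by omega
    subst this
    have : b ≠ 0 := fun hb => by have := h2 hb; omega
    simp [beta]; omega
  · obtain ⟨M, K, h1, h2, h3⟩ := vert_bound (c := c) ha hab
    by_cases hM : s ≤ M
    · exact (beta_mono hM).trans h2
    · have := beta_mono (by omega : s ≤ K)
      omega

lemma lower_odd {s a b c : ℕ} (hs : 1 ≤ s) (hab : a ≤ b) (h : 2 * s + 1 ≤ (twoKnapVert a b c).ncard) :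
    beta s + beta (s - 1) ≤ b := by
  rcases Nat.eq_zero_or_pos a with rfl | ha
  · have h1 := (vert_zero (b := b) (c := c)).1
    omega
  · obtain ⟨M, K, h1, h2, h3⟩ := vert_bound (c := c) ha hab
    by_cases hM : s + 1 ≤ M
    · obtain ⟨t, rfl⟩ : ∃ t, s = t + 1 := ⟨s - 1, by omega⟩
      have := beta_mono hM
      have e : beta (t + 1 + 1) = 2 * beta (t + 1) + beta t := rfl
      simp only [Nat.add_sub_cancel]
      omega
    · have := beta_mono (by omega : s ≤ K)
      have := beta_mono (by omega : s - 1 ≤ K - 1)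
      omega

def VS (a b r0 : ℤ) (v : ℤ × ℤ) : Prop := InS a b r0 v.1 v.2 ∧
  ∃ l : ℝ, 0 < l ∧ ∀ x r : ℤ, InS a b r0 x r → (x, r) ≠ v → l * v.1 + v.2 < l * x + r

def HasV (k : ℕ) (a b r0 : ℤ) : Prop :=
  ∃ F : Finset (ℤ × ℤ), F.card = k ∧ ∀ v ∈ F, VS a b r0 v

lemma HasV_congr {k : ℕ} {a b r0 a' : ℤ} (ha : b ∣ a - a') (h : HasV k a b r0) :
    HasV k a' b r0 := by
  obtain ⟨F, hF, h⟩ := h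
  refine ⟨F, hF, fun v hv => ?_⟩
  have := h v hv
  unfold VS at *
  simpa only [InS_congr ha (by simp : b ∣ r0 - r0)] using this

lemma zero_col {a b r0 r : ℤ} (h0 : 0 ≤ r0) (h1 : r0 < b) (h : InS a b r0 0 r) (hne : r ≠ r0) :
    r0 < r := by
  obtain ⟨-, hr, k, hk⟩ := h
  have hk' : r = r0 + b * k := by linarith
  rcases lt_trichotomy k 0 with h | h | h
  · nlinarith
  · subst h; simp at hk'; omega
  · nlinarith

lemma VS0_l {a b r0 : ℤ} (h0 : 0 ≤ r0) (h1 : r0 < b) {l : ℝ} (hl : r0 < l) :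
    ∀ x r : ℤ, InS a b r0 x r → (x, r) ≠ (0, r0) → l * (0 : ℤ) + r0 < l * x + r := by
  intro x r h hne
  have hl0 : 0 < l := lt_of_le_of_lt (by exact_mod_cast h0) hl
  have hrR : (0 : ℝ) ≤ r := by exact_mod_cast h.2.1
  rcases h.1.eq_or_lt with rfl | hx
  · have := zero_col h0 h1 h (fun hh => hne (by rw [hh]))
    have : (r0 : ℝ) < r := by exact_mod_cast this
    linarith
  · have : (1 : ℝ) ≤ x := by exact_mod_cast hx
    have := mul_le_mul_of_nonneg_left this hl0.le
    push_cast; linarith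

lemma VS0 {a b r0 : ℤ} (h0 : 0 ≤ r0) (h1 : r0 < b) : VS a b r0 (0, r0) := by
  have : (0 : ℝ) ≤ r0 := by exact_mod_cast h0
  exact ⟨⟨le_rfl, h0, by simp⟩, r0 + 1, by linarith, VS0_l h0 h1 (by linarith)⟩

lemma VS_lt {a b r0 : ℤ} {v : ℤ × ℤ} (h0 : 0 ≤ r0) (h1 : r0 < b) (h : VS a b r0 v) :
    ∃ l : ℝ, 0 < l ∧ l < b ∧
      ∀ x r : ℤ, InS a b r0 x r → (x, r) ≠ v → l * v.1 + v.2 < l * x + r := by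
  have h0R : (0 : ℝ) ≤ r0 := by exact_mod_cast h0
  have h1R : (r0 : ℝ) + 1 ≤ b := by exact_mod_cast h1
  by_cases hv : v = (0, r0)
  · subst hv
    exact ⟨r0 + 1 / 2, by linarith, by linarith, VS0_l h0 h1 (by linarith)⟩
  · obtain ⟨hin, l, hl, hmin⟩ := h
    refine ⟨l, hl, ?_, hmin⟩
    have h2 := hmin 0 r0 ⟨le_rfl, h0, by simp⟩ (Ne.symm hv)
    simp only [Int.cast_zero, mul_zero, zero_add] at h2
    have hv2 : (0 : ℝ) ≤ v.2 := by exact_mod_cast hin.2.1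
    rcases hin.1.eq_or_lt with h3 | h3
    · exfalso
      rw [← h3] at hin h2
      have hne : v.2 ≠ r0 := fun hh => hv (Prod.ext h3.symm hh)
      have := zero_col h0 h1 hin hne
      have : (r0 : ℝ) < v.2 := by exact_mod_cast this
      simp at h2
      linarith
    · have : (1 : ℝ) ≤ v.1 := by exact_mod_cast h3
      have := mul_le_mul_of_nonneg_left this hl.le
      linarith

lemma HasV_succ {k : ℕ} {a b r0 a' b' r0' : ℤ} (h0 : 0 ≤ r0) (h1 : r0 < b)
    (h : HasV k a' b' r0') (g : ℤ × ℤ → ℤ × ℤ)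
    (hg : ∀ v, VS a' b' r0' v → VS a b r0 (g v) ∧ 1 ≤ (g v).1)
    (hinj : ∀ v w, VS a' b' r0' v → VS a' b' r0' w → g v = g w → v = w) :
    HasV (k + 1) a b r0 := by
  classical
  obtain ⟨F, hF, h⟩ := h
  refine ⟨insert (0, r0) (F.image g), ?_, ?_⟩
  · rw [Finset.card_insert_of_notMem, Finset.card_image_of_injOn, hF]
    · intro v hv w hw e
      exact hinj v w (h v hv) (h w hw) e
    · intro hh
      obtain ⟨v, hv, e⟩ := Finset.mem_image.1 hh
      have := (hg v (h v hv)).2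
      rw [e] at this; simp at this
  · intro v hv
    rcases Finset.mem_insert.1 hv with rfl | hv
    · exact VS0 h0 h1
    · obtain ⟨w, hw, rfl⟩ := Finset.mem_image.1 hv
      exact (hg w (h w hw)).1

lemma stepQ {k : ℕ} {a e r : ℤ} (h0 : 0 ≤ r) (h1 : r < e) (hea : e ≤ a) (h : HasV k a e r) :
    HasV (k + 1) a (a + e) (a + r) := by
  have he : 0 < e := by omega
  have heR : (0 : ℝ) < e := by exact_mod_cast he
  have heaR : (e : ℝ) ≤ a := by exact_mod_cast hea
  have id : ∀ v, VS a e r v → e * ((v.2 - r + a * v.1) / e) = v.2 - r + a * v.1 := fun v hv =>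
    Int.mul_ediv_cancel' hv.1.2.2
  refine HasV_succ (by omega) (by omega) h
    (fun v => (v.1 + 1 + (v.2 - r + a * v.1) / e, v.2)) ?_ ?_
  · intro v hv
    have hy := id v hv
    set y := (v.2 - r + a * v.1) / e with hydef
    have hx0 := hv.1.1
    have hr0 := hv.1.2.1
    have hy0 : 0 ≤ y := by
      by_contra hn
      have := mul_nonneg (by omega : 0 ≤ a) hx0
      nlinarith
    obtain ⟨l, hl, hle, hmin⟩ := VS_lt h0 h1 hv
    refine ⟨⟨⟨by simp only; omega, hr0, y, by simp only; linear_combination -hy⟩, ?_⟩,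
      by simp only; omega⟩
    have hbl : 0 < (a : ℝ) + e - l := by linarith
    refine ⟨l * e / (a + e - l), by positivity, ?_⟩
    rintro X R ⟨hX, hR, Y, hY⟩ hne
    have hY0 : 0 ≤ Y := by
      by_contra hn
      have := mul_nonneg (by omega : 0 ≤ a) hX
      nlinarith
    have key : l * v.1 + v.2 < l * ((X - 1 - Y : ℤ) : ℝ) + R := by
      by_cases hneg : 0 ≤ X - 1 - Y
      · refine hmin _ _ ⟨hneg, hR, Y, by linear_combination hY⟩ ?_
        rintro rfl
        apply hne
        simp only at hy ⊢
        have : y = Y := by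
          have : e * y = e * Y := by linear_combination hy + hY
          exact mul_left_cancel₀ he.ne' this
        rw [this]
        exact Prod.ext (by simp only; ring) rfl
      · have hle2 : l * v.1 + v.2 ≤ r := by
          by_cases hv0 : v = (0, r)
          · rw [hv0]; simp
          · have := hmin 0 r ⟨le_rfl, h0, by simp⟩ (Ne.symm hv0)
            simp at this; linarith
        have hRe : (R : ℝ) = r + e * Y - a * ((X - 1 - Y : ℤ) : ℝ) := by
          have : R = r + e * Y - a * (X - 1 - Y) := by linear_combination hY
          exact_mod_cast this
        have hj : ((X - 1 - Y : ℤ) : ℝ) ≤ -1 := by exact_mod_cast (by omega : X - 1 - Y ≤ -1)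
        have hYR : (0 : ℝ) ≤ Y := by exact_mod_cast hY0
        have := mul_nonneg heR.le hYR
        rw [hRe]
        nlinarith [mul_pos (by linarith : 0 < (a : ℝ) - l) (by linarith : 0 < -((X - 1 - Y : ℤ) : ℝ))]
    have hyR : (e : ℝ) * y = v.2 - r + a * v.1 := by exact_mod_cast hy
    have hYR : (R : ℝ) - (a + r) + a * X = (a + e) * Y := by exact_mod_cast hY
    push_cast at key ⊢
    have E1 : l * e / (a + e - l) * (v.1 + 1 + y) + v.2
      = ((a + e) * (l * v.1 + v.2) + l * e - l * r) / (a + e - l) := by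
      field_simp; linear_combination l * hyR
    have E2 : l * e / (a + e - l) * X + R
      = ((a + e) * (l * (X - 1 - Y) + R) + l * e - l * r) / (a + e - l) := by
      field_simp; linear_combination -l * hYR
    rw [E1, E2]
    apply div_lt_div_of_pos_right _ hbl
    have := mul_lt_mul_of_pos_left key (by linarith : (0 : ℝ) < a + e)
    linarith
  · intro v w hv hw hvw
    have h3 := id v hv
    have h4 := id w hw
    simp only [Prod.mk.injEq] at hvw
    obtain ⟨h5, h6⟩ := hvw
    refine Prod.ext ?_ h6
    have : (a + e) * v.1 = (a + e) * w.1 := by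
      rw [h6] at h3 h5
      linear_combination e * h5 - h3 + h4
    exact mul_left_cancel₀ (by omega : a + e ≠ 0) this

lemma rev1 {k : ℕ} {a b a' r1 : ℤ} (hd : a ∣ a' + b) (h0 : 0 ≤ r1) (h1 : r1 < a) (hb : a + r1 < b)
    (h : HasV k a' a r1) : HasV (k + 1) a b (a + r1) := by
  have ha : 0 < a := by omega
  have haR : (0 : ℝ) < a := by exact_mod_cast ha
  have hbR : (0 : ℝ) < b := by exact_mod_cast (by omega : 0 < b)
  have id : ∀ v, VS a' a r1 v → a * ((a + r1 + b * v.1 - v.2) / a) = a + r1 + b * v.1 - v.2 := by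
    intro v hv
    apply Int.mul_ediv_cancel'
    have := hv.1.2.2
    have e : a + r1 + b * v.1 - v.2 = a + (a' + b) * v.1 - (v.2 - r1 + a' * v.1) := by ring
    rw [e]
    exact dvd_sub (dvd_add dvd_rfl (hd.mul_right _)) this
  refine HasV_succ (by omega) (by omega) h
    (fun v => ((a + r1 + b * v.1 - v.2) / a, v.2)) ?_ ?_
  · intro v hv
    have hx := id v hv
    set x := (a + r1 + b * v.1 - v.2) / a with hxdef
    have hy0 := hv.1.1
    have hr0 := hv.1.2.1
    obtain ⟨l, hl, hmin⟩ := hv.2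
    have hv2 : v.2 ≤ r1 := by
      by_cases hv0 : v = (0, r1)
      · rw [hv0]
      · have := hmin 0 r1 ⟨le_rfl, h0, by simp⟩ (Ne.symm hv0)
        simp at this
        have hy0R : (0 : ℝ) ≤ v.1 := by exact_mod_cast hy0
        have := mul_nonneg hl.le hy0R
        have : (v.2 : ℝ) ≤ r1 := by linarith
        exact_mod_cast this
    have hx1 : 1 ≤ x := by
      by_contra hn
      have := mul_nonneg (by omega : 0 ≤ b) hy0
      nlinarith
    refine ⟨⟨⟨by simp only; omega, hr0, v.1, by simp only; linear_combination hx⟩, ?_⟩, hx1⟩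
    refine ⟨l * a / (b + l), by positivity, ?_⟩
    rintro X R ⟨hX, hR, Y, hY⟩ hne
    have hY0 : 0 ≤ Y := by
      by_contra hn
      have := mul_nonneg (by omega : 0 ≤ a) hX
      nlinarith
    have key : l * v.1 + v.2 < l * Y + R := by
      refine hmin _ _ ⟨hY0, hR, ?_⟩ ?_
      · have e : R - r1 + a' * Y = a * (1 - X) + (a' + b) * Y := by linear_combination hY
        rw [e]
        exact dvd_add (dvd_mul_right _ _) (hd.mul_right _)
      · rintro rfl
        apply hne
        simp only at hx ⊢
        have : x = X := by
          have : a * x = a * X := by linear_combination hx - hY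
          exact mul_left_cancel₀ ha.ne' this
        rw [this]
    have hxR : (a : ℝ) * x = a + r1 + b * v.1 - v.2 := by exact_mod_cast hx
    have hYR : (R : ℝ) - (a + r1) + a * X = b * Y := by exact_mod_cast hY
    have E1 : l * a / (b + l) * x + v.2
      = (b * (l * v.1 + v.2) + l * (a + r1)) / (b + l) := by
      field_simp; linear_combination l * hxR
    have E2 : l * a / (b + l) * X + R
      = (b * (l * Y + R) + l * (a + r1)) / (b + l) := by
      field_simp; linear_combination l * hYR
    simp only
    rw [E1, E2]
    apply div_lt_div_of_pos_right _ (by positivity)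
    have := mul_lt_mul_of_pos_left key hbR
    linarith
  · intro v w hv hw hvw
    have h3 := id v hv
    have h4 := id w hw
    simp only [Prod.mk.injEq] at hvw
    obtain ⟨h5, h6⟩ := hvw
    refine Prod.ext ?_ h6
    have : b * v.1 = b * w.1 := by
      rw [h5] at h3
      linear_combination h4 - h3 + h6
    exact mul_left_cancel₀ (by omega : b ≠ 0) this

lemma beta_rec (n : ℕ) : beta (n + 2) = 2 * beta (n + 1) + beta n := rfl

lemma beta_pos (n : ℕ) : 0 < beta (n + 1) := by
  have := beta_mono (by omega : 1 ≤ n + 1)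
  have h1 : beta 1 = 1 := rfl
  omega

lemma hasA (m : ℕ) : ∃ r : ℤ, 0 ≤ r ∧ r < beta (m + 1) ∧ HasV (m + 1) (beta m) (beta (m + 1)) r := by
  induction m using Nat.twoStepInduction with
  | zero =>
    refine ⟨0, le_rfl, by simp [beta], {(0, 0)}, by simp, ?_⟩
    intro v hv
    rw [Finset.mem_singleton] at hv; subst hv
    exact VS0 le_rfl (by simp [beta])
  | one =>
    refine ⟨1, by norm_num, by simp [beta], {(0, 1), (1, 0)}, by simp, ?_⟩
    have e1 : ((beta 1 : ℕ) : ℤ) = 1 := rfl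
    have e2 : ((beta (1 + 1) : ℕ) : ℤ) = 2 := rfl
    rw [e1, e2]
    intro v hv
    rw [Finset.mem_insert, Finset.mem_singleton] at hv
    rcases hv with rfl | rfl
    · exact VS0 (by norm_num) (by norm_num)
    · refine ⟨⟨by norm_num, le_rfl, by simp⟩, 1 / 2, by norm_num, ?_⟩
      rintro x r ⟨hx, hr, k, hk⟩ hne
      have : 2 ≤ x + 2 * r := by
        by_contra hn
        have : r = 0 := by omega
        subst this
        have : x ≠ 1 := fun hh => hne (by rw [hh])
        omega
      have : (2 : ℝ) ≤ x + 2 * r := by exact_mod_cast this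
      simp; linarith
  | more n ih _ =>
    obtain ⟨r, h0, h1, h⟩ := ih
    have p1 := beta_pos n
    have e2 := beta_rec n
    have e3 := beta_rec (n + 1)
    have h' : HasV (n + 1) (beta (n + 1) + beta n : ℤ) (beta (n + 1)) r :=
      HasV_congr ⟨-1, by ring⟩ h
    have hq := stepQ h0 h1 (by omega) h'
    have e2' : (beta (n + 1) + beta n : ℤ) + beta (n + 1) = beta (n + 2) := by
      rw [e2]; push_cast; ring
    rw [e2'] at hq
    refine ⟨beta (n + 2) + (beta (n + 1) + beta n + r), by omega, ?_, ?_⟩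
    · have : beta (n + 2 + 1) = 2 * beta (n + 2) + beta (n + 1) := e3
      rw [this]; push_cast; omega
    · refine rev1 (a' := beta (n + 1) + beta n) ⟨3, ?_⟩ (by omega) (by omega) ?_ hq
      · have : beta (n + 2 + 1) = 2 * beta (n + 2) + beta (n + 1) := e3
        rw [this]; push_cast; rw [e2]; push_cast; ring
      · have : beta (n + 2 + 1) = 2 * beta (n + 2) + beta (n + 1) := e3
        rw [this]; push_cast; omega

lemma hasB (s : ℕ) : ∃ r : ℤ, HasV (s + 1) (beta (s + 1)) (beta (s + 1) + beta s) r := by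
  rcases s with _ | n
  · refine ⟨0, {(0, 0)}, by simp, ?_⟩
    intro v hv
    rw [Finset.mem_singleton] at hv; subst hv
    exact VS0 le_rfl (by simp [beta])
  · obtain ⟨r, h0, h1, h⟩ := hasA n
    have e2 := beta_rec n
    have e2' : beta (n + 1 + 1) = 2 * beta (n + 1) + beta n := e2
    have h' : HasV (n + 1) (beta (n + 1 + 1)) (beta (n + 1)) r :=
      HasV_congr ⟨-2, by rw [e2']; push_cast; ring⟩ h
    exact ⟨_, stepQ h0 h1 (by omega) h'⟩

lemma beta_coprime (n : ℕ) : IsCoprime (beta n : ℤ) (beta (n + 1) : ℤ) := by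
  induction n with
  | zero => exact ⟨0, 1, by simp [beta]⟩
  | succ n ih =>
    obtain ⟨u, v, h⟩ := ih
    refine ⟨v - 2 * u, u, ?_⟩
    have : beta (n + 1 + 1) = 2 * beta (n + 1) + beta n := rfl
    rw [this]; push_cast; linear_combination h

lemma VS_point {a b r0 c : ℤ} {v : ℤ × ℤ} (h : VS a b r0 v) (hc : b ∣ c - r0) :
    b * ((c - v.2 - a * v.1) / b) = c - v.2 - a * v.1 := by
  apply Int.mul_ediv_cancel'
  have e : c - v.2 - a * v.1 = (c - r0) - (v.2 - r0 + a * v.1) := by ring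
  rw [e]
  exact dvd_sub hc h.1.2.2

lemma VS_func {a b r0 c : ℤ} {v : ℤ × ℤ} {y : ℤ} (h : VS a b r0 v) (hc : b ∣ c - r0)
    (hb : 0 < b) (hy : b * y = c - v.2 - a * v.1) (hy0 : 0 ≤ y) :
    InT a b c v.1 y ∧ ∃ α β : ℝ, ∀ X Y : ℤ, InT a b c X Y → (X, Y) ≠ (v.1, y) →
      α * X + β * Y < α * v.1 + β * y := by
  obtain ⟨⟨h0, h1, h2⟩, l, hl, hmin⟩ := h
  refine ⟨⟨h0, hy0, by linarith⟩, a - l, b, ?_⟩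
  rintro X Y ⟨hX, hY, hXY⟩ hne
  have := hmin X (c - a * X - b * Y) ⟨hX, by linarith, ?_⟩ ?_
  · have hyR : (b : ℝ) * y = c - v.2 - a * v.1 := by exact_mod_cast hy
    push_cast at this
    linarith
  · have e : c - a * X - b * Y - r0 + a * X = (c - r0) - b * Y := by ring
    rw [e]
    exact dvd_sub hc (dvd_mul_right _ _)
  · rintro rfl
    apply hne
    simp only at hy ⊢
    have : b * Y = b * y := by linarith
    rw [mul_left_cancel₀ hb.ne' this]

lemma assemble {a b M K : ℕ} (ha : 0 < a) (hb : 0 < b) (hab : IsCoprime (a : ℤ) (b : ℤ))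
    {r0 r0' : ℤ} (hU : HasV M a b r0) (hL : HasV K b a r0') :
    ∃ c : ℕ, 1 + M + K ≤ (twoKnapVert a b c).ncard := by
  classical
  obtain ⟨F, hF, hFv⟩ := hU
  obtain ⟨G, hG, hGv⟩ := hL
  obtain ⟨u, w, huw⟩ := hab
  have haZ : (0 : ℤ) < a := by exact_mod_cast ha
  have hbZ : (0 : ℤ) < b := by exact_mod_cast hb
  obtain ⟨B, hB0, hBF, hBG⟩ : ∃ B : ℤ, 0 ≤ B ∧ (∀ v ∈ F, v.1 ≤ B ∧ v.2 ≤ B) ∧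
      (∀ v ∈ G, v.1 ≤ B ∧ v.2 ≤ B) := by
    have hsum : ∀ v ∈ F ∪ G, 0 ≤ v.1 + v.2 ∧ 0 ≤ v.1 ∧ 0 ≤ v.2 := by
      intro v hv
      rcases Finset.mem_union.1 hv with hv | hv
      · have := (hFv v hv).1; exact ⟨add_nonneg this.1 this.2.1, this.1, this.2.1⟩
      · have := (hGv v hv).1; exact ⟨add_nonneg this.1 this.2.1, this.1, this.2.1⟩
    have hle : ∀ v ∈ F ∪ G, v.1 + v.2 ≤ ∑ v ∈ F ∪ G, (v.1 + v.2) := fun v hv =>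
      Finset.single_le_sum (f := fun v : ℤ × ℤ => v.1 + v.2) (fun i hi => (hsum i hi).1) hv
    refine ⟨∑ v ∈ F ∪ G, (v.1 + v.2), Finset.sum_nonneg (fun i hi => (hsum i hi).1), ?_, ?_⟩
    · intro v hv
      have h1 := hle v (Finset.mem_union_left _ hv)
      have h2 := hsum v (Finset.mem_union_left _ hv)
      omega
    · intro v hv
      have h1 := hle v (Finset.mem_union_right _ hv)
      have h2 := hsum v (Finset.mem_union_right _ hv)
      omega
  obtain ⟨c, hcb, hca, hcB⟩ : ∃ c : ℤ, (b : ℤ) ∣ c - r0 ∧ (a : ℤ) ∣ c - r0' ∧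
      B + a * B + b * B < c := by
    set c0 := r0' * (w * b) + r0 * (u * a) with hc0
    set N := |c0| + (B + a * B + b * B) + 1 with hN
    have hN0 : 0 ≤ N := by positivity
    refine ⟨c0 + a * b * N, ⟨r0' * w - r0 * w + a * N, ?_⟩, ⟨r0 * u - r0' * u + b * N, ?_⟩, ?_⟩
    · rw [hc0]; linear_combination r0 * huw
    · rw [hc0]; linear_combination r0' * huw
    · have h1 : 1 ≤ (a : ℤ) * b := by nlinarith
      have h2 := mul_le_mul_of_nonneg_right h1 hN0
      have h3 := neg_abs_le c0
      linarith
  have hc0 : 0 ≤ c := by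
    have := mul_nonneg haZ.le hB0
    have := mul_nonneg hbZ.le hB0
    omega
  lift c to ℕ using hc0
  refine ⟨c, ?_⟩
  set g : ℤ × ℤ → ℤ × ℤ := fun v => (v.1, ((c : ℤ) - v.2 - a * v.1) / b) with hg
  set h : ℤ × ℤ → ℤ × ℤ := fun v => (((c : ℤ) - v.2 - b * v.1) / a, v.1) with hh
  have gE : ∀ v ∈ F, (b : ℤ) * (g v).2 = c - v.2 - a * v.1 := fun v hv => VS_point (hFv v hv) hcb
  have hE : ∀ v ∈ G, (a : ℤ) * (h v).1 = c - v.2 - b * v.1 := fun v hv => VS_point (hGv v hv) hca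
  have g2 : ∀ v ∈ F, B < (g v).2 := by
    intro v hv
    have h1 := gE v hv
    have h2 := hBF v hv
    have h3 := mul_le_mul_of_nonneg_left h2.1 haZ.le
    by_contra hn
    have := mul_le_mul_of_nonneg_left (not_lt.1 hn) hbZ.le
    linarith
  have h1 : ∀ v ∈ G, 0 < (h v).1 := by
    intro v hv
    have h1 := hE v hv
    have h2 := hBG v hv
    have h3 := mul_le_mul_of_nonneg_left h2.1 hbZ.le
    have h4 := mul_nonneg haZ.le hB0
    by_contra hn
    have := mul_le_mul_of_nonneg_left (not_lt.1 hn) haZ.le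
    linarith
  set E : Finset (ℤ × ℤ) := insert (0, 0) (F.image g ∪ G.image h) with hEdef
  have cardE : E.card = 1 + M + K := by
    have d : Disjoint (F.image g) (G.image h) := by
      rw [Finset.disjoint_left]
      intro p hp hq
      obtain ⟨v, hv, rfl⟩ := Finset.mem_image.1 hp
      obtain ⟨v', hv', e⟩ := Finset.mem_image.1 hq
      have i1 := g2 v hv
      have i2 := (hBG v' hv').1
      rw [← e] at i1
      simp only [hh] at i1
      omega
    have n : ((0 : ℤ), (0 : ℤ)) ∉ F.image g ∪ G.image h := by
      intro hm
      rcases Finset.mem_union.1 hm with hm | hm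
      · obtain ⟨v, hv, e⟩ := Finset.mem_image.1 hm
        have := g2 v hv
        rw [e] at this; simp only at this; omega
      · obtain ⟨v, hv, e⟩ := Finset.mem_image.1 hm
        have := h1 v hv
        rw [e] at this; simp only at this; omega
    rw [hEdef, Finset.card_insert_of_notMem n, Finset.card_union_of_disjoint d,
      Finset.card_image_of_injOn, Finset.card_image_of_injOn, hF, hG]
    · ring
    · intro v hv v' hv' e
      have e1 := hE v hv
      have e2 := hE v' hv'
      rw [e] at e1
      have e3 : v.1 = v'.1 := congrArg Prod.snd e
      refine Prod.ext e3 ?_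
      rw [e3] at e1; linarith
    · intro v hv v' hv' e
      have e1 := gE v hv
      have e2 := gE v' hv'
      rw [e] at e1
      have e3 : v.1 = v'.1 := by
        have e4 : (g v).1 = (g v').1 := by rw [e]
        exact e4
      refine Prod.ext e3 ?_
      rw [e3] at e1; linarith
  have sub : ((E.image emb : Finset (ℝ × ℝ)) : Set (ℝ × ℝ)) ⊆ twoKnapVert a b c := by
    intro p hp
    rw [Finset.mem_coe] at hp
    obtain ⟨q, hq, rfl⟩ := Finset.mem_image.1 hp
    have main : InT a b c q.1 q.2 ∧ ∃ α β : ℝ, ∀ X Y : ℤ, InT a b c X Y → (X, Y) ≠ q →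
        α * X + β * Y < α * q.1 + β * q.2 := by
      rcases Finset.mem_insert.1 hq with rfl | hq
      · refine ⟨⟨le_rfl, le_rfl, by simp⟩, -1, -1, ?_⟩
        rintro X Y ⟨hX, hY, -⟩ hne
        have : 0 < X + Y := by
          by_contra hn
          exact hne (Prod.ext (by simp only; omega) (by simp only; omega))
        have : (0 : ℝ) < X + Y := by exact_mod_cast this
        simp; linarith
      rcases Finset.mem_union.1 hq with hq | hq
      · obtain ⟨v, hv, rfl⟩ := Finset.mem_image.1 hq
        have := VS_func (hFv v hv) hcb hbZ (gE v hv) (by have := g2 v hv; omega)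
        exact this
      · obtain ⟨v, hv, rfl⟩ := Finset.mem_image.1 hq
        obtain ⟨i1, α, β, i2⟩ := VS_func (hGv v hv) hca haZ (hE v hv) (by have := h1 v hv; omega)
        refine ⟨InT_swap i1, β, α, ?_⟩
        intro X Y hXY hne
        have := i2 Y X (InT_swap hXY) (by
          intro e
          apply hne
          simp only [Prod.mk.injEq] at e
          exact Prod.ext e.2 e.1)
        have e : (h v).2 = v.1 := rfl
        rw [e]
        linarith
    obtain ⟨m1, α, β, m2⟩ := main
    rw [tkv_eq]
    refine ext_of_functional (mem_kT.2 ⟨q, rfl, m1⟩) α β ?_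
    intro p hp hne
    obtain ⟨t, rfl, ht⟩ := mem_kT.1 hp
    exact m2 t.1 t.2 ht (fun e => hne (by rw [← e]))
  have hfin : (twoKnapVert a b c).Finite := by
    rw [tkv_eq]
    exact (kT_finite ha hb).subset extremePoints_convexHull_subset
  have := Set.ncard_le_ncard sub hfin
  rw [Set.ncard_coe_finset, Finset.card_image_of_injective _ emb_inj, cardE] at this
  exact this

lemma upper_odd (t : ℕ) : ∃ a c : ℕ, a ≤ beta (t + 1) + beta t ∧
    2 * (t + 1) + 1 ≤ (twoKnapVert a (beta (t + 1) + beta t) c).ncard := by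
  obtain ⟨r, hr⟩ := hasB t
  obtain ⟨r', -, -, hr'⟩ := hasA t
  have p := beta_pos t
  have hcop : IsCoprime (beta (t + 1) : ℤ) ((beta (t + 1) + beta t : ℕ) : ℤ) := by
    obtain ⟨u, v, h⟩ := beta_coprime t
    exact ⟨v - u, u, by push_cast; linear_combination h⟩
  have hL : HasV (t + 1) ((beta (t + 1) + beta t : ℕ) : ℤ) (beta (t + 1)) r' :=
    HasV_congr ⟨-1, by push_cast; ring⟩ hr'
  obtain ⟨c, hc⟩ := assemble (r0 := r) p (by omega) hcop (by push_cast; exact hr) hL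
  exact ⟨beta (t + 1), c, by omega, by omega⟩

lemma upper_even (t : ℕ) : ∃ a c : ℕ, a ≤ beta (t + 1) ∧
    2 * (t + 1) ≤ (twoKnapVert a (beta (t + 1)) c).ncard := by
  rcases t with _ | n
  · obtain ⟨a, c, h1, h2⟩ := upper_odd 0
    have e : beta (0 + 1) + beta 0 = beta (0 + 1) := rfl
    rw [e] at h1 h2
    exact ⟨a, c, h1, by omega⟩
  · obtain ⟨r, -, -, hr⟩ := hasA (n + 1)
    obtain ⟨r', -, -, hr'⟩ := hasA n
    have hL : HasV (n + 1) (beta (n + 1 + 1)) (beta (n + 1)) r' :=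
      HasV_congr ⟨-2, by rw [beta_rec]; push_cast; ring⟩ hr'
    obtain ⟨c, hc⟩ := assemble (beta_pos n) (beta_pos (n + 1)) (beta_coprime (n + 1)) hr hL
    exact ⟨beta (n + 1), c, beta_mono (by omega), by omega⟩



/-- Veselov–Shevchenko: for `b_t = min {b : ∃ a ≤ b and c with |𝒩(a,b,c)| ≥ t}`, one has
`b_{2s} = β_s` and `b_{2s+1} = β_s + β_{s−1}`. -/
theorem minimal_b_for_vertex_count (s : ℕ) (hs : 1 ≤ s) :
    IsLeast {b : ℕ | ∃ a c : ℕ, a ≤ b ∧ 2 * s ≤ (twoKnapVert a b c).ncard} (beta s) ∧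
    IsLeast {b : ℕ | ∃ a c : ℕ, a ≤ b ∧ 2 * s + 1 ≤ (twoKnapVert a b c).ncard}
      (beta s + beta (s - 1)) := by
  refine ⟨⟨?_, ?_⟩, ⟨?_, ?_⟩⟩
  · obtain ⟨t, rfl⟩ : ∃ t, s = t + 1 := ⟨s - 1, by omega⟩
    exact upper_even t
  · rintro b ⟨a, c, hab, h⟩
    exact lower_even hs hab h
  · obtain ⟨t, rfl⟩ : ∃ t, s = t + 1 := ⟨s - 1, by omega⟩
    exact upper_odd t
  · rintro b ⟨a, c, hab, h⟩
    exact lower_odd hs hab h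
end

section
/- For every natural number n ≥ 1, the convex hull of the set of nonnegative integer solutions (x₁,…,xₙ) of 2^{n−1}x₁ + 2^{n−2}x₂ + ⋯ + 2x_{n−1} + xₙ ≤ 2ⁿ − 1 has exactly 2ⁿ vertices. -/
/-- `ℳ(a, a₀)`: the set of nonnegative integer solutions of `∑ aⱼ xⱼ ≤ a₀`,
viewed inside `ℝⁿ`. -/
def knapPoints (n : ℕ) (a : Fin n → ℕ) (a₀ : ℕ) : Set (Fin n → ℝ) :=
  {x | (∀ j, ∃ z : ℤ, x j = (z : ℝ)) ∧ (∀ j, 0 ≤ x j) ∧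
       ∑ j, (a j : ℝ) * x j ≤ (a₀ : ℝ)}

/-- `𝒩(a, a₀)`: the set of vertices (extreme points) of the knapsack polytope,
the convex hull of `ℳ(a, a₀)`. -/
def knapVert (n : ℕ) (a : Fin n → ℕ) (a₀ : ℕ) : Set (Fin n → ℝ) :=
  Set.extremePoints ℝ (convexHull ℝ (knapPoints n a a₀))

namespace KV

noncomputable def W {n : ℕ} (x : Fin n → ℝ) (i : ℕ) : ℝ := if h : i < n then x ⟨i, h⟩ else 0

noncomputable def T {n : ℕ} (x : Fin n → ℝ) (m : ℕ) : ℝ :=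
  ∑ i ∈ Finset.range m, (2:ℝ) ^ (n - 1 - i) * W x i

abbrev K (n : ℕ) : Set (Fin n → ℝ) :=
  knapPoints n (fun j : Fin n => 2 ^ (n - 1 - (j : ℕ))) (2 ^ n - 1)

lemma W_fin {n : ℕ} (x : Fin n → ℝ) (i : Fin n) : W x i = x i := by simp [W]

lemma T_succ {n : ℕ} (x : Fin n → ℝ) (i : Fin n) :
    T x (i + 1) = T x i + (2:ℝ) ^ (n - 1 - (i:ℕ)) * x i := by
  rw [T, Finset.sum_range_succ, W_fin]; rfl

lemma T_full {n : ℕ} (x : Fin n → ℝ) : T x n = ∑ j : Fin n, (2:ℝ) ^ (n - 1 - (j:ℕ)) * x j := by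
  rw [T, Finset.sum_range]; simp [W_fin]

lemma T_comb {n : ℕ} (x y : Fin n → ℝ) (a b : ℝ) (m : ℕ) :
    T (a • x + b • y) m = a * T x m + b * T y m := by
  simp only [T, Finset.mul_sum, ← Finset.sum_add_distrib]
  refine Finset.sum_congr rfl fun i _ => ?_
  unfold W
  split_ifs
  · simp; ring
  · simp

lemma mem_K {n : ℕ} (x : Fin n → ℝ) : x ∈ K n ↔
    (∀ j, ∃ z : ℤ, x j = (z : ℝ)) ∧ (∀ j, 0 ≤ x j) ∧ T x n ≤ 2 ^ n - 1 := by
  rw [T_full]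
  have : ((2 ^ n - 1 : ℕ) : ℝ) = 2 ^ n - 1 := by
    rw [Nat.cast_sub Nat.one_le_two_pow]; simp
  simp only [K, knapPoints, Set.mem_ofPred_eq, this]
  simp

lemma T_mono {n : ℕ} {x : Fin n → ℝ} (hx : ∀ j, 0 ≤ x j) {m k : ℕ} (h : m ≤ k) :
    T x m ≤ T x k := by
  unfold T
  apply Finset.sum_le_sum_of_subset_of_nonneg
  · simpa using h
  · intro i _ _
    have : 0 ≤ W x i := by
      unfold W; split_ifs
      · exact hx _
      · exact le_rfl
    positivity

lemma T_eq_of_zero {n : ℕ} {x : Fin n → ℝ} {m k : ℕ} (h : m ≤ k)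
    (hz : ∀ j : Fin n, m ≤ j → (j:ℕ) < k → x j = 0) : T x m = T x k := by
  unfold T
  apply Finset.sum_subset
  · simpa using h
  · intro i hi hi'
    simp only [Finset.mem_range, not_lt] at hi hi'
    unfold W; split_ifs with hh
    · rw [hz ⟨i, hh⟩ hi' hi]; simp
    · simp

lemma T_int {n : ℕ} {x : Fin n → ℝ} (hx : ∀ j, ∃ z : ℤ, x j = (z : ℝ)) (k : Fin n) :
    ∃ z : ℤ, T x (k + 1) = 2 ^ (n - 1 - (k:ℕ)) * (z:ℝ) := by
  choose f hf using hx
  refine ⟨∑ i ∈ Finset.range (k+1), 2 ^ ((k:ℕ) - i) * (if h : i < n then f ⟨i, h⟩ else 0), ?_⟩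
  push_cast
  rw [T, Finset.mul_sum]
  refine Finset.sum_congr rfl fun i hi => ?_
  have hik : i ≤ k := by simpa [Nat.lt_succ_iff] using hi
  have hk := k.2
  have hi' : i < n := by omega
  rw [← mul_assoc, ← pow_add, W, dif_pos hi', dif_pos hi', hf]
  congr 2
  omega

lemma pow_split {n : ℕ} (k : Fin n) : (2:ℝ) ^ n = 2 ^ (n - 1 - (k:ℕ)) * 2 ^ ((k:ℕ)+1) := by
  rw [← pow_add]; congr 1; omega

/-- either tight or slack at least one unit -/
lemma T_slack {n : ℕ} {x : Fin n → ℝ} (hx : x ∈ K n) (k : Fin n) :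
    T x (k + 1) = 2 ^ n - 2 ^ (n - 1 - (k:ℕ)) ∨
    T x (k + 1) ≤ 2 ^ n - 2 * 2 ^ (n - 1 - (k:ℕ)) := by
  obtain ⟨h1, h2, h3⟩ := (mem_K x).1 hx
  obtain ⟨z, hz⟩ := T_int h1 k
  have hm := T_mono h2 (show (k:ℕ) + 1 ≤ n from k.2)
  have hp : (0:ℝ) < 2 ^ (n - 1 - (k:ℕ)) := by positivity
  have hlt : (z:ℝ) < 2 ^ ((k:ℕ)+1) := by
    have : T x (k+1) < 2 ^ n := by linarith
    rw [hz, pow_split k] at this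
    exact lt_of_mul_lt_mul_left this hp.le
  have hlt' : z < 2 ^ ((k:ℕ)+1) := by exact_mod_cast hlt
  rcases (show z = 2 ^ ((k:ℕ)+1) - 1 ∨ z ≤ 2 ^ ((k:ℕ)+1) - 2 by omega) with h | h
  · left; rw [hz, pow_split k, h]; push_cast; ring
  · right
    have : (z:ℝ) ≤ 2 ^ ((k:ℕ)+1) - 2 := by exact_mod_cast h
    rw [hz, pow_split k]
    nlinarith

lemma T_le {n : ℕ} {x : Fin n → ℝ} (hx : x ∈ K n) (k : Fin n) :
    T x (k + 1) ≤ 2 ^ n - 2 ^ (n - 1 - (k:ℕ)) := by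
  have hp : (0:ℝ) < 2 ^ (n - 1 - (k:ℕ)) := by positivity
  rcases T_slack hx k with h | h <;> linarith

def P (n : ℕ) : Set (Fin n → ℝ) :=
  {x | (∀ j, 0 ≤ x j) ∧ ∀ k : Fin n, T x (k + 1) ≤ 2 ^ n - 2 ^ (n - 1 - (k:ℕ))}

lemma hull_sub (n : ℕ) : convexHull ℝ (K n) ⊆ P n := by
  apply convexHull_min
  · intro x hx
    exact ⟨((mem_K x).1 hx).2.1, T_le hx⟩
  · intro x hx y hy a b ha hb hab
    refine ⟨fun j => ?_, fun k => ?_⟩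
    · have := hx.1 j; have := hy.1 j
      simp only [Pi.add_apply, Pi.smul_apply, smul_eq_mul]; positivity
    · rw [T_comb]
      have h1 := mul_le_mul_of_nonneg_left (hx.2 k) ha
      have h2 := mul_le_mul_of_nonneg_left (hy.2 k) hb
      have : (2:ℝ) ^ n - 2 ^ (n - 1 - (k:ℕ)) = a * (2 ^ n - 2 ^ (n - 1 - (k:ℕ))) + b * (2 ^ n - 2 ^ (n - 1 - (k:ℕ))) := by
        rw [← add_mul, hab, one_mul]
      linarith

open Classical in
noncomputable def R (n : ℕ) (S : Finset (Fin n)) : ℕ → ℤ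
  | 0 => 2 ^ n
  | m + 1 => if ∃ k ∈ S, (k:ℕ) = m then 2 ^ (n - 1 - m) else R n S m

lemma R_mem {n : ℕ} {S : Finset (Fin n)} {k : Fin n} (h : k ∈ S) :
    R n S (k + 1) = 2 ^ (n - 1 - (k:ℕ)) := by
  rw [R, if_pos ⟨k, h, rfl⟩]

lemma R_not_mem {n : ℕ} {S : Finset (Fin n)} {k : Fin n} (h : k ∉ S) :
    R n S (k + 1) = R n S k := by
  rw [R, if_neg]
  rintro ⟨l, hl, e⟩
  exact h (Fin.ext e ▸ hl)

lemma R_dvd {n : ℕ} (S : Finset (Fin n)) (m : ℕ) : (2:ℤ) ^ (n - m) ∣ R n S m := by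
  induction m with
  | zero => simp [R]
  | succ m ih =>
    rw [R]; split_ifs
    · exact pow_dvd_pow _ (by omega)
    · exact (pow_dvd_pow _ (by omega)).trans ih

lemma R_pos {n : ℕ} (S : Finset (Fin n)) (m : ℕ) : 0 < R n S m := by
  induction m with
  | zero => simp [R]
  | succ m ih =>
    rw [R]; split_ifs
    · positivity
    · exact ih

lemma R_ge {n : ℕ} (S : Finset (Fin n)) (m : ℕ) : (2:ℤ) ^ (n - m) ≤ R n S m :=
  Int.le_of_dvd (R_pos S m) (R_dvd S m)

noncomputable def v (n : ℕ) (S : Finset (Fin n)) : Fin n → ℝ :=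
  fun k => ((R n S k : ℝ) - R n S (k + 1)) / 2 ^ (n - 1 - (k:ℕ))

lemma T_char {n : ℕ} (S : Finset (Fin n)) (x : Fin n → ℝ) (h0 : ∀ k, k ∉ S → x k = 0)
    (h1 : ∀ k ∈ S, T x (k + 1) = 2 ^ n - 2 ^ (n - 1 - (k:ℕ))) (m : ℕ) (hm : m ≤ n) :
    T x m = 2 ^ n - R n S m := by
  induction m with
  | zero => simp [T, R]
  | succ m ih =>
    have := T_succ x ⟨m, hm⟩
    by_cases hS : (⟨m, hm⟩ : Fin n) ∈ S
    · have e := R_mem hS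
      have e' := h1 _ hS
      simp only at e e'
      rw [e, e']; push_cast; rfl
    · have e := R_not_mem hS
      rw [h0 _ hS] at this
      simp only at e this
      rw [e, this, ih (by omega)]; ring

lemma eq_v {n : ℕ} (S : Finset (Fin n)) (x : Fin n → ℝ)
    (h : ∀ m ≤ n, T x m = 2 ^ n - R n S m) : x = v n S := by
  funext k
  have h1 := h k k.2.le
  have h2 := h (k+1) k.2
  rw [T_succ, h1] at h2
  rw [v, eq_div_iff (by positivity)]
  linarith

lemma T_v {n : ℕ} (S : Finset (Fin n)) (m : ℕ) (hm : m ≤ n) :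
    T (v n S) m = 2 ^ n - R n S m := by
  induction m with
  | zero => simp [T, R]
  | succ m ih =>
    have := T_succ (v n S) ⟨m, hm⟩
    simp only at this
    rw [this, ih (by omega), v, mul_div_cancel₀ _ (by positivity)]
    simp

lemma v_not_mem {n : ℕ} {S : Finset (Fin n)} {k : Fin n} (h : k ∉ S) : v n S k = 0 := by
  simp [v, R_not_mem h]

lemma v_mem {n : ℕ} {S : Finset (Fin n)} {k : Fin n} (h : k ∈ S) : 0 < v n S k := by
  rw [v, R_mem h]
  apply div_pos _ (by positivity)
  have : (2:ℤ) ^ (n - 1 - (k:ℕ)) < R n S k :=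
    lt_of_lt_of_le (pow_lt_pow_right₀ (by norm_num) (by omega)) (R_ge S k)
  have : (2:ℝ) ^ (n - 1 - (k:ℕ)) < R n S k := by exact_mod_cast this
  push_cast
  linarith

lemma v_inj (n : ℕ) : Function.Injective (v n) := by
  intro S S' h
  ext k
  have := congrFun h k
  by_cases h1 : k ∈ S <;> by_cases h2 : k ∈ S' <;> simp only [h1, h2]
  · have := v_mem h1; have := v_not_mem h2; linarith
  · have := v_mem h2; have := v_not_mem h1; linarith

lemma v_K {n : ℕ} (S : Finset (Fin n)) : v n S ∈ K n := by
  rw [mem_K]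
  refine ⟨fun j => ?_, fun j => ?_, ?_⟩
  · have h1 : (2:ℤ) ^ (n - 1 - (j:ℕ)) ∣ R n S j := (pow_dvd_pow _ (by omega)).trans (R_dvd S j)
    have h2 : (2:ℤ) ^ (n - 1 - (j:ℕ)) ∣ R n S (j+1) := (pow_dvd_pow _ (by omega)).trans (R_dvd S (j+1))
    obtain ⟨z, hz⟩ := dvd_sub h1 h2
    refine ⟨z, ?_⟩
    have hz' : (R n S j : ℝ) - R n S (j+1) = 2 ^ (n - 1 - (j:ℕ)) * z := by exact_mod_cast hz
    rw [v, hz', mul_div_cancel_left₀ _ (by positivity)]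
  · by_cases h : j ∈ S
    · exact (v_mem h).le
    · exact (v_not_mem h).ge
  · rw [T_v S n le_rfl]
    have : (1:ℝ) ≤ R n S n := by exact_mod_cast R_pos S n
    linarith

lemma v_extreme {n : ℕ} (S : Finset (Fin n)) : v n S ∈ Set.extremePoints ℝ (convexHull ℝ (K n)) := by
  rw [mem_extremePoints_iff_left]
  refine ⟨subset_convexHull ℝ _ (v_K S), ?_⟩
  rintro x hx y hy ⟨a, b, ha, hb, hab, hv⟩
  have hx := hull_sub n hx
  have hy := hull_sub n hy
  apply eq_v
  apply T_char
  · intro k hk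
    have h := congrFun hv k
    rw [v_not_mem hk] at h
    simp only [Pi.add_apply, Pi.smul_apply, smul_eq_mul] at h
    have h1 := mul_nonneg ha.le (hx.1 k)
    have h2 := mul_nonneg hb.le (hy.1 k)
    have : a * x k = 0 := by linarith
    simpa [ha.ne'] using this
  · intro k hk
    have h := T_v S (k+1) k.2
    rw [← hv, T_comb, R_mem hk] at h
    push_cast at h
    refine le_antisymm (hx.2 k) ?_
    have h2 := mul_le_mul_of_nonneg_left (hy.2 k) hb.le
    have e : (2:ℝ) ^ n - 2 ^ (n - 1 - (k:ℕ)) = a * (2 ^ n - 2 ^ (n - 1 - (k:ℕ))) + b * (2 ^ n - 2 ^ (n - 1 - (k:ℕ))) := by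
      rw [← add_mul, hab, one_mul]
    refine le_of_mul_le_mul_left ?_ ha
    linarith

lemma no_pert {n : ℕ} {x d : Fin n → ℝ} (hx : x ∈ Set.extremePoints ℝ (convexHull ℝ (K n)))
    (h1 : x + d ∈ K n) (h2 : x - d ∈ K n) : d = 0 := by
  rw [mem_extremePoints_iff_left] at hx
  have := hx.2 _ (subset_convexHull ℝ _ h1) _ (subset_convexHull ℝ _ h2)
    ⟨1/2, 1/2, by norm_num, by norm_num, by norm_num, by
      funext j; simp; ring⟩
  simpa using this

lemma T_add {n : ℕ} (x y : Fin n → ℝ) (m : ℕ) : T (x + y) m = T x m + T y m := by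
  simpa using T_comb x y 1 1 m

lemma T_sub {n : ℕ} (x y : Fin n → ℝ) (m : ℕ) : T (x - y) m = T x m - T y m := by
  have := T_comb x y 1 (-1) m
  simpa [sub_eq_add_neg] using this

lemma T_single {n : ℕ} (k : Fin n) (c : ℝ) : T (Pi.single k c) n = 2 ^ (n - 1 - (k:ℕ)) * c := by
  rw [T_full, Finset.sum_eq_single k]
  · simp
  · intro j _ hj; simp [hj]
  · simp

lemma tight {n : ℕ} {x : Fin n → ℝ} (hx : x ∈ Set.extremePoints ℝ (convexHull ℝ (K n))) (t : ℕ) :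
    ∀ k : Fin n, n - k ≤ t → x k ≠ 0 → T x (k + 1) = 2 ^ n - 2 ^ (n - 1 - (k:ℕ)) := by
  have hK : x ∈ K n := extremePoints_convexHull_subset hx
  obtain ⟨hint, hnn, hT⟩ := (mem_K x).1 hK
  have hge1 : ∀ j, x j ≠ 0 → 1 ≤ x j := by
    intro j hj
    obtain ⟨z, hz⟩ := hint j
    have h0 := lt_of_le_of_ne (hnn j) hj.symm
    rw [hz] at h0 ⊢
    have : 0 < z := by exact_mod_cast h0
    exact_mod_cast this
  induction t with
  | zero => intro k hk; omega
  | succ t ih =>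
    intro k hkt hk
    rcases T_slack hK k with h | h
    · exact h
    exfalso
    have hp1 : (1:ℝ) ≤ 2 ^ (n - 1 - (k:ℕ)) := one_le_pow₀ (by norm_num)
    by_cases hex : ∃ l : ℕ, (k:ℕ) < l ∧ ∃ hl : l < n, x ⟨l, hl⟩ ≠ 0
    · classical
      obtain ⟨hkl, hl, hxl⟩ := Nat.find_spec hex
      have hmin : ∀ j : Fin n, (k:ℕ)+1 ≤ j → (j:ℕ) < Nat.find hex → x j = 0 := by
        intro j hj hj'
        by_contra hne
        exact Nat.find_min hex hj' ⟨hj, j.2, hne⟩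
      set l' := Nat.find hex
      set l : Fin n := ⟨l', hl⟩ with hldef
      have hll : (l:ℕ) = l' := rfl
      have ht := ih l (by omega) hxl
      rw [T_succ, ← T_eq_of_zero (show (k:ℕ)+1 ≤ l from hkl) hmin] at ht
      have hpw : (2:ℝ) ^ (n - 1 - (k:ℕ)) = 2 ^ (n - 1 - (l:ℕ)) * 2 ^ ((l:ℕ) - k) := by
        rw [← pow_add]; congr 1; omega
      have hq : (0:ℝ) < 2 ^ (n - 1 - (l:ℕ)) := by positivity
      have hr : (1:ℝ) ≤ 2 ^ ((l:ℕ) - k) := one_le_pow₀ (by norm_num)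
      have hbig : (2:ℝ) ^ ((l:ℕ) - k) ≤ x l := by
        refine le_of_mul_le_mul_left ?_ hq
        rw [hpw] at h
        nlinarith
      have hne : k ≠ l := by
        intro e; rw [Fin.ext_iff] at e; omega
      set d : Fin n → ℝ := Pi.single k 1 - Pi.single l (2 ^ ((l:ℕ) - k)) with hd
      have dk : d k = 1 := by simp [hd, hne]
      have dl : d l = - 2 ^ ((l:ℕ) - k) := by simp [hd, hne.symm]
      have dj : ∀ j, j ≠ k → j ≠ l → d j = 0 := by
        intro j h1 h2; simp [hd, h1, h2]
      have Td : T d n = 0 := by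
        rw [hd, T_sub, T_single, T_single, hpw]; ring
      have dint : ∀ j, ∃ z : ℤ, d j = z := by
        intro j
        by_cases h1 : j = k
        · exact ⟨1, by rw [h1, dk]; simp⟩
        by_cases h2 : j = l
        · exact ⟨- 2 ^ ((l:ℕ) - k), by rw [h2, dl]; push_cast; rfl⟩
        · exact ⟨0, by rw [dj j h1 h2]; simp⟩
      have dabs : ∀ j, -x j ≤ d j ∧ d j ≤ x j := by
        intro j
        by_cases h1 : j = k
        · have := hge1 k hk
          rw [h1, dk]; constructor <;> linarith
        by_cases h2 : j = l
        · rw [h2, dl]; constructor <;> linarith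
        · have := hnn j
          rw [dj j h1 h2]; constructor <;> linarith
      have hz := no_pert hx (d := d) (by
        rw [mem_K]
        refine ⟨fun j => ?_, fun j => ?_, ?_⟩
        · obtain ⟨a, ha⟩ := hint j
          obtain ⟨b, hb⟩ := dint j
          exact ⟨a + b, by simp [ha, hb]⟩
        · have := dabs j
          simp only [Pi.add_apply]; linarith
        · rw [T_add, Td]; linarith) (by
        rw [mem_K]
        refine ⟨fun j => ?_, fun j => ?_, ?_⟩
        · obtain ⟨a, ha⟩ := hint j
          obtain ⟨b, hb⟩ := dint j
          exact ⟨a - b, by simp [ha, hb]⟩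
        · have := dabs j
          simp only [Pi.sub_apply]; linarith
        · rw [T_sub, Td]; linarith)
      rw [hz] at dk
      simp at dk
    · push Not at hex
      have hTe : T x (k+1) = T x n := T_eq_of_zero k.2 (fun j hj _ => hex j hj j.2)
      have dint : ∀ j, ∃ z : ℤ, (Pi.single k 1 : Fin n → ℝ) j = z := by
        intro j
        by_cases h1 : j = k
        · exact ⟨1, by rw [h1]; simp⟩
        · exact ⟨0, by simp [h1]⟩
      have dabs : ∀ j, -x j ≤ (Pi.single k 1 : Fin n → ℝ) j ∧ (Pi.single k 1 : Fin n → ℝ) j ≤ x j := by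
        intro j
        by_cases h1 : j = k
        · have := hge1 k hk
          rw [h1, Pi.single_eq_same]; constructor <;> linarith
        · have := hnn j
          rw [Pi.single_eq_of_ne h1]; constructor <;> linarith
      have hz := no_pert hx (d := Pi.single k 1) (by
        rw [mem_K]
        refine ⟨fun j => ?_, fun j => ?_, ?_⟩
        · obtain ⟨a, ha⟩ := hint j
          obtain ⟨b, hb⟩ := dint j
          exact ⟨a + b, by simp only [Pi.add_apply, ha, hb]; push_cast; rfl⟩
        · have := dabs j
          simp only [Pi.add_apply]; linarith
        · rw [T_add, T_single]; linarith) (by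
        rw [mem_K]
        refine ⟨fun j => ?_, fun j => ?_, ?_⟩
        · obtain ⟨a, ha⟩ := hint j
          obtain ⟨b, hb⟩ := dint j
          exact ⟨a - b, by simp only [Pi.sub_apply, ha, hb]; push_cast; rfl⟩
        · have := dabs j
          simp only [Pi.sub_apply]; linarith
        · rw [T_sub, T_single]; linarith)
      have := congrFun hz k
      simp at this

lemma extreme_eq (n : ℕ) : Set.extremePoints ℝ (convexHull ℝ (K n)) = Set.range (v n) := by
  classical
  ext x
  constructor
  · intro hx
    refine ⟨Finset.univ.filter (fun k => x k ≠ 0), (eq_v _ _ (T_char _ _ ?_ ?_)).symm⟩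
    · intro k hk; simpa using hk
    · intro k hk
      exact tight hx n k (by omega) (by simpa using hk)
  · rintro ⟨S, rfl⟩
    exact v_extreme S

end KV

/-- The knapsack polytope of `2^{n−1}x₁ + 2^{n−2}x₂ + ⋯ + 2x_{n−1} + xₙ ≤ 2ⁿ − 1`
has exactly `2ⁿ` vertices. -/
theorem card_knapVert_pow_two (n : ℕ) (hn : 1 ≤ n) :
    (knapVert n (fun j : Fin n => 2 ^ (n - 1 - (j : ℕ))) (2 ^ n - 1)).ncard = 2 ^ n := by
  have h : knapVert n (fun j : Fin n => 2 ^ (n - 1 - (j : ℕ))) (2 ^ n - 1) = Set.range (KV.v n) :=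
    KV.extreme_eq n
  rw [h, ← Set.image_univ, Set.ncard_image_of_injective _ (KV.v_inj n), Set.ncard_univ]
  simp
end

section
/- For every n there is a positive constant cₙ depending only on n such that for every natural number α ≥ 2 there exist a vector a = (a₁,…,aₙ) of natural numbers and a natural number a₀ with aⱼ ≤ α for j = 0,1,…,n and |𝒩(a,a₀)| ≥ cₙ · (log₂ α)^{n−1}. -/
def Feas {m p : ℕ} (ω : (Fin m → ZMod p) × ZMod p) (y : ℕ × (Fin m → ℕ)) : Prop :=
  (y.1 : ZMod p) + ∑ j, ω.1 j * (y.2 j : ZMod p) = ω.2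

theorem vertex_of_unique_min {n : ℕ} (S : Set (Fin n → ℝ)) (f : (Fin n → ℝ) →ₗ[ℝ] ℝ)
    (x : Fin n → ℝ) (hx : x ∈ S) (h : ∀ y ∈ S, y ≠ x → f x < f y) :
    x ∈ Set.extremePoints ℝ (convexHull ℝ S) := by
  have hsub : convexHull ℝ S ⊆ {y | y = x ∨ f x < f y} := by
    apply convexHull_min
    · intro y hy
      by_cases hyx : y = x
      · exact Or.inl hyx
      · exact Or.inr (h y hy hyx)
    · intro y hy z hz a b ha hb hab
      rcases hy with rfl | hy
      · rcases hz with rfl | hz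
        · left
          rw [← add_smul, hab, one_smul]
        · rcases hb.eq_or_lt with rfl | hb'
          · left
            have : a = 1 := by linarith
            simp [this]
          · right
            have : a = 1 - b := by linarith
            subst this
            simp only [map_add, map_smul, smul_eq_mul]
            nlinarith
      · rcases hz with rfl | hz
        · rcases ha.eq_or_lt with rfl | ha'
          · left
            have : b = 1 := by linarith
            simp [this]
          · right
            have : b = 1 - a := by linarith
            subst this
            simp only [map_add, map_smul, smul_eq_mul]
            nlinarith
        · right
          have : b = 1 - a := by linarith
          subst this
          simp only [map_add, map_smul, smul_eq_mul]
          rcases ha.eq_or_lt with rfl | ha'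
          · simpa using hz
          · nlinarith
  refine ⟨subset_convexHull ℝ S hx, ?_⟩
  intro y hy z hz hxyz
  obtain ⟨a, b, ha, hb, hab, hxe⟩ := hxyz
  have hfx : a * f y + b * f z = f x := by
    rw [← hxe]; simp
  have ha1 : a = 1 - b := by linarith
  rcases hsub hy with h1 | h1
  · exact h1
  · exfalso
    rcases hsub hz with h2 | h2
    · rw [h2] at hfx
      subst ha1
      nlinarith
    · subst ha1
      nlinarith

theorem card_feas {m p : ℕ} [NeZero p] (y : ℕ × (Fin m → ℕ)) [DecidablePred fun ω : (Fin m → ZMod p) × ZMod p => Feas ω y] :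
    (Finset.univ.filter (fun ω : (Fin m → ZMod p) × ZMod p => Feas ω y)).card = p ^ m := by
  have : (Finset.univ.filter (fun ω : (Fin m → ZMod p) × ZMod p => Feas ω y)).card
      = (Finset.univ : Finset (Fin m → ZMod p)).card := by
    apply Finset.card_bij (fun ω _ => ω.1)
    · simp
    · intro a ha b hb hab
      replace ha := (Finset.mem_filter.mp ha).2
      replace hb := (Finset.mem_filter.mp hb).2
      unfold Feas at ha hb
      refine Prod.ext hab ?_
      rw [← ha, ← hb, hab]
    · intro g _
      exact ⟨(g, (y.1 : ZMod p) + ∑ j, g j * (y.2 j : ZMod p)),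
        Finset.mem_filter.mpr ⟨Finset.mem_univ _, rfl⟩, rfl⟩
  rw [this]
  simp [ZMod.card]

theorem card_pair {m p : ℕ} [Fact p.Prime] (y z : ℕ × (Fin m → ℕ))
    (hy1 : y.1 < p) (hz1 : z.1 < p) (hy2 : ∀ j, y.2 j < p) (hz2 : ∀ j, z.2 j < p) (hne : y ≠ z)
    [DecidablePred fun ω : (Fin m → ZMod p) × ZMod p => Feas ω y ∧ Feas ω z] :
    (Finset.univ.filter (fun ω : (Fin m → ZMod p) × ZMod p => Feas ω y ∧ Feas ω z)).card * p ≤ p ^ m := by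
  classical
  have inj : ∀ a b : ℕ, a < p → b < p → (a : ZMod p) = (b : ZMod p) → a = b := by
    intro a b ha hb h
    rw [ZMod.natCast_eq_natCast_iff'] at h
    rwa [Nat.mod_eq_of_lt ha, Nat.mod_eq_of_lt hb] at h
  by_cases hx : y.2 = z.2
  · have : (Finset.univ.filter (fun ω : (Fin m → ZMod p) × ZMod p => Feas ω y ∧ Feas ω z)) = ∅ := by
      rw [Finset.filter_eq_empty_iff]
      rintro ω _ ⟨h1, h2⟩
      apply hne
      refine Prod.ext (inj _ _ hy1 hz1 ?_) hx
      unfold Feas at h1 h2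
      rw [hx, ← h2] at h1
      exact add_right_cancel h1
    rw [this]; simp
  · obtain ⟨j, hj⟩ := Function.ne_iff.mp hx
    have hj' : ((y.2 j : ZMod p)) - (z.2 j : ZMod p) ≠ 0 := by
      intro h
      exact hj (inj _ _ (hy2 j) (hz2 j) (sub_eq_zero.mp h))
    have h1 : (Finset.univ.filter (fun ω : (Fin m → ZMod p) × ZMod p => Feas ω y ∧ Feas ω z)).card * p
       = ((Finset.univ.filter (fun ω : (Fin m → ZMod p) × ZMod p => Feas ω y ∧ Feas ω z)) ×ˢ (Finset.univ : Finset (ZMod p))).card := by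
      rw [Finset.card_product, Finset.card_univ, ZMod.card]
    have h2 : p ^ m = (Finset.univ : Finset (Fin m → ZMod p)).card := by
      simp [ZMod.card]
    rw [h1, h2]
    apply Finset.card_le_card_of_injOn (fun q => Function.update q.1.1 j q.2)
    · intro _ _; simp
    · rintro ⟨⟨g, g0⟩, c⟩ hq ⟨⟨g', g0'⟩, c'⟩ hq' heq
      replace hq := (Finset.mem_filter.mp (Finset.mem_product.mp hq).1).2
      replace hq' := (Finset.mem_filter.mp (Finset.mem_product.mp hq').1).2
      simp only [Feas] at hq hq' heq
      have hc : c = c' := by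
        have := congrFun heq j
        simpa using this
      have hoff : ∀ i, i ≠ j → g i = g' i := by
        intro i hi
        have := congrFun heq i
        simpa [hi] using this
      obtain ⟨e1, e2⟩ := hq
      obtain ⟨e3, e4⟩ := hq'
      have key : (∑ i, (g i - g' i) * ((y.2 i : ZMod p) - (z.2 i : ZMod p))) = 0 := by
        simp only [sub_mul, mul_sub, Finset.sum_sub_distrib]
        linear_combination e1 - e2 - e3 + e4
      rw [Finset.sum_eq_single j] at key
      · have hgj : g j = g' j := by
          rcases mul_eq_zero.mp key with h | h
          · exact sub_eq_zero.mp h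
          · exact absurd h hj'
        have hg : g = g' := by
          funext i
          by_cases hi : i = j
          · rw [hi, hgj]
          · exact hoff i hi
        subst hg
        subst hc
        have : g0 = g0' := by rw [← e1, ← e3]
        rw [this]
      · intro i _ hi
        rw [hoff i hi]; simp
      · simp

def GoodEv {m p : ℕ} (A S : Finset (ℕ × (Fin m → ℕ))) (ω : (Fin m → ZMod p) × ZMod p) : Prop :=
  ∃ y ∈ A, Feas ω y ∧ ∀ y' ∈ S, Feas ω y' → y' = y

theorem card_goodEv {m p : ℕ} [Fact p.Prime] (A S : Finset (ℕ × (Fin m → ℕ)))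
    (hAS : A ⊆ S) (h1 : ∀ y ∈ S, y.1 < p) (h2 : ∀ y ∈ S, ∀ j, y.2 j < p) (hS : 2 * S.card ≤ p)
    [DecidablePred fun ω : (Fin m → ZMod p) × ZMod p => GoodEv A S ω] :
    A.card * p ^ m ≤ 2 * (Finset.univ.filter (fun ω : (Fin m → ZMod p) × ZMod p => GoodEv A S ω)).card := by
  classical
  have hp : 0 < p := (Fact.out : p.Prime).pos
  set F : (ℕ × (Fin m → ℕ)) → Finset ((Fin m → ZMod p) × ZMod p) := fun y => Finset.univ.filter (fun ω => Feas ω y) with hF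
  set U : (ℕ × (Fin m → ℕ)) → Finset ((Fin m → ZMod p) × ZMod p) := fun y =>
    F y \ (S.erase y).biUnion (fun y' => Finset.univ.filter (fun ω => Feas ω y ∧ Feas ω y')) with hU
  have hUc : ∀ y ∈ S, p ^ m ≤ 2 * (U y).card := by
    intro y hy
    have a1 : (F y).card ≤ (U y).card + ((S.erase y).biUnion (fun y' => Finset.univ.filter (fun ω : (Fin m → ZMod p) × ZMod p => Feas ω y ∧ Feas ω y'))).card := by
      have := Finset.le_card_sdiff ((S.erase y).biUnion (fun y' => Finset.univ.filter (fun ω : (Fin m → ZMod p) × ZMod p => Feas ω y ∧ Feas ω y'))) (F y)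
      simp only [hU]
      omega
    have a2 : ((S.erase y).biUnion (fun y' => Finset.univ.filter (fun ω : (Fin m → ZMod p) × ZMod p => Feas ω y ∧ Feas ω y'))).card * p ≤ S.card * p ^ m := by
      calc _ ≤ (∑ y' ∈ S.erase y, (Finset.univ.filter (fun ω : (Fin m → ZMod p) × ZMod p => Feas ω y ∧ Feas ω y')).card) * p :=
            Nat.mul_le_mul_right _ Finset.card_biUnion_le
        _ = ∑ y' ∈ S.erase y, (Finset.univ.filter (fun ω : (Fin m → ZMod p) × ZMod p => Feas ω y ∧ Feas ω y')).card * p := by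
            rw [Finset.sum_mul]
        _ ≤ ∑ y' ∈ S.erase y, p ^ m := by
            apply Finset.sum_le_sum
            intro y' hy'
            rw [Finset.mem_erase] at hy'
            exact card_pair y y' (h1 y hy) (h1 y' hy'.2) (h2 y hy) (h2 y' hy'.2) (Ne.symm hy'.1)
        _ = (S.erase y).card * p ^ m := by simp
        _ ≤ _ := Nat.mul_le_mul_right _ (Finset.card_le_card (Finset.erase_subset _ _))
    have a3 : (F y).card = p ^ m := card_feas y
    rw [a3] at a1
    set B := ((S.erase y).biUnion (fun y' => Finset.univ.filter (fun ω : (Fin m → ZMod p) × ZMod p => Feas ω y ∧ Feas ω y'))).card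
    have a4 : 2 * B ≤ p ^ m := by
      have : (2 * B) * p ≤ p ^ m * p := by
        calc (2 * B) * p = 2 * (B * p) := by ring
          _ ≤ 2 * (S.card * p ^ m) := by omega
          _ = (2 * S.card) * p ^ m := by ring
          _ ≤ p * p ^ m := Nat.mul_le_mul_right _ hS
          _ = _ := by ring
      exact Nat.le_of_mul_le_mul_right this hp
    omega
  have hmem : ∀ y ω, ω ∈ U y → Feas ω y ∧ ∀ y' ∈ S, Feas ω y' → y' = y := by
    intro y ω hω
    simp only [hU, hF, Finset.mem_sdiff, Finset.mem_filter, Finset.mem_univ, true_and,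
      Finset.mem_biUnion, Finset.mem_erase, not_exists, not_and] at hω
    refine ⟨hω.1, fun y' hy' hf => ?_⟩
    by_contra hne
    exact hω.2 y' ⟨hne, hy'⟩ hω.1 hf
  have hdisj : (A : Set (ℕ × (Fin m → ℕ))).PairwiseDisjoint U := by
    intro y hy z hz hyz
    rw [Function.onFun, Finset.disjoint_left]
    intro ω hω hω'
    exact hyz ((hmem z ω hω').2 y (hAS hy) (hmem y ω hω).1)
  have hsub : A.biUnion U ⊆ Finset.univ.filter (fun ω : (Fin m → ZMod p) × ZMod p => GoodEv A S ω) := by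
    intro ω hω
    rw [Finset.mem_biUnion] at hω
    obtain ⟨y, hy, hω⟩ := hω
    simp only [Finset.mem_filter, Finset.mem_univ, true_and]
    exact ⟨y, hy, hmem y ω hω⟩
  calc A.card * p ^ m = ∑ y ∈ A, p ^ m := by simp
    _ ≤ ∑ y ∈ A, 2 * (U y).card := Finset.sum_le_sum (fun y hy => hUc y (hAS hy))
    _ = 2 * (A.biUnion U).card := by rw [Finset.card_biUnion hdisj, Finset.mul_sum]
    _ ≤ _ := Nat.mul_le_mul_left _ (Finset.card_le_card hsub)

theorem exists_omega {ι Ω : Type*} [Fintype ι] [Fintype Ω] [Nonempty Ω] (E : ι → Ω → Prop)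
    [∀ i, DecidablePred (E i)] (C : ℕ)
    (h : ∀ i, Fintype.card Ω ≤ C * (Finset.univ.filter (fun ω => E i ω)).card) :
    ∃ ω, Fintype.card ι ≤ C * (Finset.univ.filter (fun i => E i ω)).card := by
  by_contra hcon
  push Not at hcon
  have h1 : ∑ i : ι, Fintype.card Ω ≤ ∑ i : ι, C * (Finset.univ.filter (fun ω => E i ω)).card :=
    Finset.sum_le_sum (fun i _ => h i)
  have h2 : ∑ ω : Ω, C * (Finset.univ.filter (fun i => E i ω)).card < ∑ ω : Ω, Fintype.card ι :=
    Finset.sum_lt_sum_of_nonempty Finset.univ_nonempty (fun ω _ => hcon ω)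
  have h3 : ∑ i : ι, (Finset.univ.filter (fun ω => E i ω)).card = ∑ ω : Ω, (Finset.univ.filter (fun i => E i ω)).card :=
    Finset.sum_card_bipartiteAbove_eq_sum_card_bipartiteBelow E
  rw [← Finset.mul_sum] at h1 h2
  rw [h3] at h1
  simp only [Finset.sum_const, Finset.card_univ, smul_eq_mul] at h1 h2
  rw [mul_comm] at h1
  omega

/-- box of candidate vertices -/
def boxA (m K : ℕ) (i : Fin m → Fin K) : Finset (ℕ × (Fin m → ℕ)) :=
  Finset.range (2 ^ (m * K - ∑ j, (i j : ℕ))) ×ˢ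
    Fintype.piFinset (fun j => Finset.Ico (2 ^ (i j : ℕ)) (2 ^ ((i j : ℕ) + 1)))

/-- bigger box -/
def boxS (m K : ℕ) (i : Fin m → Fin K) : Finset (ℕ × (Fin m → ℕ)) :=
  Finset.range ((m + 1) * 2 ^ (m * K - ∑ j, (i j : ℕ)) + 1) ×ˢ
    Fintype.piFinset (fun j => Finset.range ((m + 1) * 2 ^ ((i j : ℕ) + 1) + 1))

theorem sum_le_mK {m K : ℕ} (i : Fin m → Fin K) : ∑ j, (i j : ℕ) ≤ m * K := by
  calc ∑ j, (i j : ℕ) ≤ ∑ _j : Fin m, K := Finset.sum_le_sum (fun j _ => (i j).2.le)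
    _ = m * K := by simp

theorem card_boxA {m K : ℕ} (i : Fin m → Fin K) : (boxA m K i).card = 2 ^ (m * K) := by
  have : ∀ j, 2 ^ ((i j : ℕ) + 1) - 2 ^ (i j : ℕ) = 2 ^ (i j : ℕ) := by
    intro j; rw [pow_succ]; omega
  simp only [boxA, Finset.card_product, Finset.card_range, Fintype.card_piFinset, Nat.card_Ico, this]
  rw [Finset.prod_pow_eq_pow_sum, ← pow_add, Nat.sub_add_cancel (sum_le_mK i)]

theorem card_boxS {m K : ℕ} (i : Fin m → Fin K) :
    (boxS m K i).card ≤ ((m + 2) ^ (m + 1) * 2 ^ m) * 2 ^ (m * K) := by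
  simp only [boxS, Finset.card_product, Finset.card_range, Fintype.card_piFinset]
  have h1 : ∀ e : ℕ, (m + 1) * 2 ^ e + 1 ≤ (m + 2) * 2 ^ e := by
    intro e
    have := Nat.one_le_two_pow (n := e)
    nlinarith
  calc _ ≤ ((m + 2) * 2 ^ (m * K - ∑ j, (i j : ℕ))) * ∏ j : Fin m, ((m + 2) * 2 ^ ((i j : ℕ) + 1)) :=
        Nat.mul_le_mul (h1 _) (Finset.prod_le_prod' (fun j _ => h1 _))
    _ = ((m + 2) ^ (m + 1) * 2 ^ m) * (2 ^ (m * K - ∑ j, (i j : ℕ)) * 2 ^ (∑ j, (i j : ℕ))) := by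
        rw [Finset.prod_mul_distrib, Finset.prod_pow_eq_pow_sum, Finset.sum_add_distrib]
        simp only [Finset.prod_const, Finset.sum_const, Finset.card_univ, Fintype.card_fin, smul_eq_mul, mul_one]
        ring
    _ = _ := by rw [← pow_add, Nat.sub_add_cancel (sum_le_mK i)]

theorem boxA_sub {m K : ℕ} (i : Fin m → Fin K) : boxA m K i ⊆ boxS m K i := by
  intro y hy
  simp only [boxA, boxS, Finset.mem_product, Finset.mem_range, Fintype.mem_piFinset, Finset.mem_Ico] at hy ⊢
  refine ⟨by nlinarith [hy.1], fun j => by nlinarith [(hy.2 j).2]⟩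

theorem two_pow_le {m K : ℕ} (i : Fin m → Fin K) (j : Fin m) : 2 ^ ((i j : ℕ) + 1) ≤ 2 ^ (m * K) := by
  apply Nat.pow_le_pow_right (by norm_num)
  have := (i j).2
  have := j.2
  nlinarith

theorem le_Q (m X : ℕ) (hX : 1 ≤ X) : (m + 1) * X + 1 ≤ ((m + 2) ^ (m + 1) * 2 ^ m) * X := by
  have h : m + 2 ≤ (m + 2) ^ (m + 1) * 2 ^ m := by
    calc m + 2 = (m + 2) ^ 1 * 1 := by ring
      _ ≤ _ := Nat.mul_le_mul (Nat.pow_le_pow_right (by omega) (by omega)) Nat.one_le_two_pow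
  nlinarith

theorem boxS_lt {m K p : ℕ} (i : Fin m → Fin K) (hp : ((m + 2) ^ (m + 1) * 2 ^ m) * 2 ^ (m * K) < p)
    (y : ℕ × (Fin m → ℕ)) (hy : y ∈ boxS m K i) : y.1 < p ∧ ∀ j, y.2 j < p := by
  simp only [boxS, Finset.mem_product, Finset.mem_range, Fintype.mem_piFinset] at hy
  have hQ := le_Q m (2 ^ (m * K)) Nat.one_le_two_pow
  constructor
  · have : 2 ^ (m * K - ∑ j, (i j : ℕ)) ≤ 2 ^ (m * K) := Nat.pow_le_pow_right (by norm_num) (by omega)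
    nlinarith [hy.1]
  · intro j
    nlinarith [hy.2 j, two_pow_le i j]

theorem knap_nat {n : ℕ} {a : Fin n → ℕ} {a₀ : ℕ} {x : Fin n → ℝ} (hx : x ∈ knapPoints n a a₀) :
    ∃ u : Fin n → ℕ, (∀ j, x j = (u j : ℝ)) ∧ ∑ j, a j * u j ≤ a₀ := by
  obtain ⟨h1, h2, h3⟩ := hx
  have : ∀ j, ∃ u : ℕ, x j = (u : ℝ) := by
    intro j
    obtain ⟨z, hz⟩ := h1 j
    have hz0 : 0 ≤ z := by
      have := h2 j
      rw [hz] at this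
      exact_mod_cast this
    obtain ⟨u, rfl⟩ := Int.eq_ofNat_of_zero_le hz0
    exact ⟨u, by rw [hz]; simp⟩
  choose u hu using this
  refine ⟨u, hu, ?_⟩
  simp only [hu] at h3
  exact_mod_cast h3

theorem knap_finite {n : ℕ} (a : Fin n → ℕ) (a₀ : ℕ) (ha : ∀ j, 1 ≤ a j) :
    (knapPoints n a a₀).Finite := by
  have : knapPoints n a a₀ ⊆ (fun u : Fin n → ℕ => fun j => (u j : ℝ)) '' (Set.Iic (fun _ => a₀)) := by
    intro x hx
    obtain ⟨u, hu, hs⟩ := knap_nat hx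
    refine ⟨u, ?_, ?_⟩
    · intro j
      have h1 : a j * u j ≤ ∑ j, a j * u j :=
        Finset.single_le_sum (f := fun j => a j * u j) (fun _ _ => Nat.zero_le _) (Finset.mem_univ j)
      have := ha j
      show u j ≤ a₀
      nlinarith
    · funext j; exact (hu j).symm
  exact ((Set.finite_Iic _).image _).subset this

theorem vert_finite {n : ℕ} (a : Fin n → ℕ) (a₀ : ℕ) (ha : ∀ j, 1 ≤ a j) :
    (knapVert n a a₀).Finite :=
  (knap_finite a a₀ ha).subset extremePoints_convexHull_subset

/-- coefficients -/
def coefs {m : ℕ} (p : ℕ) (b : Fin m → ℕ) : Fin (m + 1) → ℕ := Fin.cons p b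

theorem vertex_of_good {m K p : ℕ} [Fact p.Prime] (i : Fin m → Fin K)
    (hp : ((m + 2) ^ (m + 1) * 2 ^ m) * 2 ^ (m * K) < p)
    (ω : (Fin m → ZMod p) × ZMod p) (b : Fin m → ℕ) (hb : ∀ j, b j ≤ p) (hbω : ∀ j, (b j : ZMod p) = ω.1 j)
    (a₀ : ℕ) (ha₀ : (a₀ : ZMod p) = ω.2) (ha₀' : p * ((m + 1) * p) ≤ a₀)
    (hgood : GoodEv (boxA m K i) (boxS m K i) ω) :
    ∃ v ∈ knapVert (m + 1) (coefs p b) a₀, ∀ j : Fin m,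
      (2 : ℝ) ^ (i j : ℕ) ≤ v j.succ ∧ v j.succ < (2 : ℝ) ^ ((i j : ℕ) + 1) := by
  have hp0 : 0 < p := (Fact.out : p.Prime).pos
  obtain ⟨⟨s, x⟩, hy, hf, huniq⟩ := hgood
  have hlt := boxS_lt i hp _ (boxA_sub i hy)
  simp only at hlt
  simp only [boxA, Finset.mem_product, Finset.mem_range, Fintype.mem_piFinset, Finset.mem_Ico] at hy
  set w0 : ℕ := 2 ^ (m * K - ∑ j, (i j : ℕ)) with hw0
  have hw0pos : (0 : ℝ) < (w0 : ℝ) := by rw [hw0]; positivity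
  -- the first coordinate
  have hle : s + ∑ j, b j * x j ≤ a₀ := by
    have h1 : ∑ j, b j * x j ≤ ∑ _j : Fin m, p * p :=
      Finset.sum_le_sum (fun j _ => Nat.mul_le_mul (hb j) (hlt.2 j).le)
    simp only [Finset.sum_const, Finset.card_univ, Fintype.card_fin, smul_eq_mul] at h1
    nlinarith [hlt.1]
  have hdvd : p ∣ a₀ - (s + ∑ j, b j * x j) := by
    rw [← ZMod.natCast_eq_zero_iff, Nat.cast_sub hle, ha₀, sub_eq_zero]
    unfold Feas at hf
    rw [← hf]
    push_cast
    simp only [hbω]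
  obtain ⟨x0, hx0⟩ := hdvd
  have heq : p * x0 + ∑ j, b j * x j + s = a₀ := by omega
  set v : Fin (m + 1) → ℝ := Fin.cons (x0 : ℝ) (fun j => (x j : ℝ)) with hv
  have hvsum : ∑ j, (coefs p b j : ℝ) * v j = (a₀ : ℝ) - s := by
    rw [Fin.sum_univ_succ]
    simp only [coefs, hv, Fin.cons_zero, Fin.cons_succ]
    rw [← heq]; push_cast; ring
  have hvmem : v ∈ knapPoints (m + 1) (coefs p b) a₀ := by
    refine ⟨?_, ?_, ?_⟩
    · intro j
      refine Fin.cases ⟨x0, by simp [hv]⟩ (fun j => ⟨x j, by simp [hv]⟩) j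
    · intro j
      refine Fin.cases (by simp [hv]) (fun j => by simp [hv]) j
    · rw [hvsum]
      have : (0 : ℝ) ≤ s := Nat.cast_nonneg s
      linarith
  let f : (Fin (m + 1) → ℝ) →ₗ[ℝ] ℝ :=
    -(1 / (w0 : ℝ)) • (∑ j, (coefs p b j : ℝ) • LinearMap.proj j) +
      ∑ j : Fin m, (1 / (2 : ℝ) ^ ((i j : ℕ) + 1)) • LinearMap.proj j.succ
  have hfapp : ∀ u : Fin (m + 1) → ℝ, f u = -(1 / (w0 : ℝ)) * (∑ j, (coefs p b j : ℝ) * u j) +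
      ∑ j : Fin m, (1 / (2 : ℝ) ^ ((i j : ℕ) + 1)) * u j.succ := by
    intro u
    simp [f, LinearMap.sum_apply]
  refine ⟨v, vertex_of_unique_min _ f v hvmem ?_, ?_⟩
  · intro u hu hne
    by_contra hcon
    push Not at hcon
    apply hne
    obtain ⟨c, hc, hcs⟩ := knap_nat hu
    obtain ⟨t, ht⟩ := Nat.exists_eq_add_of_le hcs
    have hcsum : ∑ j, (coefs p b j : ℝ) * u j = (a₀ : ℝ) - t := by
      simp only [hc]
      rw [ht]; push_cast; ring
    have ht' : p * c 0 + ∑ j, b j * c (Fin.succ j) + t = a₀ := by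
      rw [ht, Fin.sum_univ_succ]; simp [coefs]
    rw [hfapp, hfapp, hvsum, hcsum] at hcon
    have hvb : (1 / (w0 : ℝ)) * s + ∑ j : Fin m, (1 / (2 : ℝ) ^ ((i j : ℕ) + 1)) * v j.succ ≤ m + 1 := by
      have h1 : (1 / (w0 : ℝ)) * s ≤ 1 := by
        rw [one_div, inv_mul_le_iff₀ hw0pos, mul_one]
        exact_mod_cast hy.1.le
      have h2 : ∑ j : Fin m, (1 / (2 : ℝ) ^ ((i j : ℕ) + 1)) * v j.succ ≤ ∑ _j : Fin m, (1 : ℝ) := by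
        apply Finset.sum_le_sum
        intro j _
        rw [one_div, inv_mul_le_iff₀ (by positivity), mul_one]
        simp only [hv, Fin.cons_succ]
        exact_mod_cast (hy.2 j).2.le
      simp only [Finset.sum_const, Finset.card_univ, Fintype.card_fin, nsmul_eq_mul, mul_one] at h2
      linarith
    have hub : (1 / (w0 : ℝ)) * t + ∑ j : Fin m, (1 / (2 : ℝ) ^ ((i j : ℕ) + 1)) * (c j.succ : ℝ) ≤ m + 1 := by
      simp only [← hc]
      linarith
    have hnn : ∀ j : Fin m, 0 ≤ (1 / (2 : ℝ) ^ ((i j : ℕ) + 1)) * (c j.succ : ℝ) := fun j => by positivity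
    have hmem : (t, fun j : Fin m => c j.succ) ∈ boxS m K i := by
      simp only [boxS, Finset.mem_product, Finset.mem_range, Fintype.mem_piFinset]
      constructor
      · have h1 : (1 / (w0 : ℝ)) * t ≤ m + 1 := by
          have := Finset.sum_nonneg (s := Finset.univ) (fun j _ => hnn j)
          linarith
        rw [one_div, inv_mul_le_iff₀ hw0pos] at h1
        have : t ≤ w0 * (m + 1) := by exact_mod_cast h1
        rw [mul_comm, ← hw0]; omega
      · intro j
        have h1 : (1 / (2 : ℝ) ^ ((i j : ℕ) + 1)) * (c j.succ : ℝ) ≤ m + 1 := by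
          have h3 := Finset.single_le_sum (fun j _ => hnn j) (Finset.mem_univ j)
          have : 0 ≤ (1 / (w0 : ℝ)) * t := by positivity
          linarith
        rw [one_div, inv_mul_le_iff₀ (by positivity)] at h1
        have : c j.succ ≤ 2 ^ ((i j : ℕ) + 1) * (m + 1) := by exact_mod_cast h1
        rw [mul_comm]; omega
    have hfe : Feas ω (t, fun j : Fin m => c j.succ) := by
      unfold Feas
      rw [← ha₀, ← ht']
      push_cast
      simp only [hbω, CharP.cast_eq_zero, zero_mul, zero_add]
      ring
    have he := huniq _ hmem hfe
    simp only [Prod.mk.injEq] at he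
    obtain ⟨e1, e2⟩ := he
    have e3 : ∀ j : Fin m, c j.succ = x j := fun j => congrFun e2 j
    simp only [e3, e1] at ht'
    have e4 : c 0 = x0 := by
      have : p * c 0 = p * x0 := by omega
      exact Nat.eq_of_mul_eq_mul_left hp0 this
    funext j
    rw [hc j]
    refine Fin.cases (by simp [hv, e4]) (fun j => by simp [hv, e3]) j
  · intro j
    simp only [hv, Fin.cons_succ]
    exact ⟨by exact_mod_cast (hy.2 j).1, by exact_mod_cast (hy.2 j).2⟩

theorem many_vertices (m K p : ℕ) [Fact p.Prime]
    (hp : 2 * (((m + 2) ^ (m + 1) * 2 ^ m) * 2 ^ (m * K)) < p)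
    (hp' : p ≤ 4 * (((m + 2) ^ (m + 1) * 2 ^ m) * 2 ^ (m * K))) :
    ∃ (a : Fin (m + 1) → ℕ) (a₀ : ℕ), (∀ j, a j ≤ p) ∧ a₀ ≤ (m + 2) * p ^ 2 ∧
      K ^ m ≤ 8 * ((m + 2) ^ (m + 1) * 2 ^ m) * (knapVert (m + 1) a a₀).ncard := by
  classical
  have hp0 : 0 < p := (Fact.out : p.Prime).pos
  set Q := (m + 2) ^ (m + 1) * 2 ^ m with hQ
  have hE : ∀ i : Fin m → Fin K, Fintype.card ((Fin m → ZMod p) × ZMod p) ≤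
      8 * Q * (Finset.univ.filter (fun ω : (Fin m → ZMod p) × ZMod p =>
        GoodEv (boxA m K i) (boxS m K i) ω)).card := by
    intro i
    have hlt : Q * 2 ^ (m * K) < p := by omega
    have h := card_goodEv (p := p) (boxA m K i) (boxS m K i) (boxA_sub i)
      (fun y hy => (boxS_lt i hlt y hy).1) (fun y hy => (boxS_lt i hlt y hy).2)
      (by have := card_boxS i; rw [← hQ] at this; omega)
    rw [card_boxA] at h
    have hc : Fintype.card ((Fin m → ZMod p) × ZMod p) = p * p ^ m := by
      simp [ZMod.card, mul_comm]
    rw [hc]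
    calc p * p ^ m ≤ (4 * (Q * 2 ^ (m * K))) * p ^ m := Nat.mul_le_mul_right _ hp'
      _ = 4 * Q * (2 ^ (m * K) * p ^ m) := by ring
      _ ≤ 4 * Q * (2 * _) := Nat.mul_le_mul_left _ h
      _ = _ := by ring
  obtain ⟨ω, hω⟩ := exists_omega (fun i : Fin m → Fin K => fun ω : (Fin m → ZMod p) × ZMod p =>
        GoodEv (boxA m K i) (boxS m K i) ω) (8 * Q) hE
  set b : Fin m → ℕ := fun j => if ω.1 j = 0 then p else (ω.1 j).val with hb
  have hb1 : ∀ j, b j ≤ p := by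
    intro j
    simp only [hb]
    split_ifs
    · exact le_rfl
    · exact (ZMod.val_lt _).le
  have hb2 : ∀ j, 1 ≤ b j := by
    intro j
    simp only [hb]
    split_ifs with h
    · exact hp0
    · have := (ZMod.val_ne_zero (ω.1 j)).mpr h
      omega
  have hb3 : ∀ j, (b j : ZMod p) = ω.1 j := by
    intro j
    simp only [hb]
    split_ifs with h
    · simp [h]
    · simp
  have ha1 : ∀ j, coefs p b j ≤ p := fun j => Fin.cases (by simp [coefs]) (fun j => by simpa [coefs] using hb1 j) j
  have ha2 : ∀ j, 1 ≤ coefs p b j := fun j => Fin.cases (by show 1 ≤ p; exact hp0) (fun j => by simpa [coefs] using hb2 j) j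
  refine ⟨coefs p b, ω.2.val + p * ((m + 1) * p), ha1, ?_, ?_⟩
  · have := ZMod.val_lt ω.2
    nlinarith
  · have hv : ∀ i ∈ (Finset.univ.filter (fun i : Fin m → Fin K => GoodEv (boxA m K i) (boxS m K i) ω)),
        ∃ v ∈ knapVert (m + 1) (coefs p b) (ω.2.val + p * ((m + 1) * p)), ∀ j : Fin m,
      (2 : ℝ) ^ (i j : ℕ) ≤ v j.succ ∧ v j.succ < (2 : ℝ) ^ ((i j : ℕ) + 1) := by
      intro i hi
      exact vertex_of_good i (by rw [← hQ]; omega) ω b hb1 hb3 _ (by simp) (by omega) (Finset.mem_filter.mp hi).2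
    choose! v hv1 hv2 using hv
    have hcard : (Finset.univ.filter (fun i : Fin m → Fin K => GoodEv (boxA m K i) (boxS m K i) ω)).card
        ≤ (knapVert (m + 1) (coefs p b) (ω.2.val + p * ((m + 1) * p))).ncard := by
      rw [← Set.ncard_coe_finset]
      apply Set.ncard_le_ncard_of_injOn v (ht := vert_finite _ _ ha2)
      · intro i hi; exact hv1 i hi
      · intro i hi i' hi' h
        funext j
        have h1 := hv2 i hi j
        have h2 := hv2 i' hi' j
        rw [← h] at h2
        have l1 : (2 : ℝ) ^ (i j : ℕ) < (2 : ℝ) ^ ((i' j : ℕ) + 1) := by linarith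
        have l2 : (2 : ℝ) ^ (i' j : ℕ) < (2 : ℝ) ^ ((i j : ℕ) + 1) := by linarith
        rw [pow_lt_pow_iff_right₀ (by norm_num)] at l1 l2
        apply Fin.ext
        omega
    calc K ^ m = Fintype.card (Fin m → Fin K) := by simp
      _ ≤ _ := hω
      _ ≤ _ := Nat.mul_le_mul_left _ hcard

theorem one_vertex (n : ℕ) : (knapVert n (fun _ => 1) 0).ncard = 1 := by
  have : knapPoints n (fun _ => 1) 0 = {0} := by
    ext x
    constructor
    · intro hx
      obtain ⟨u, hu, hs⟩ := knap_nat hx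
      have : ∀ j, u j = 0 := by simpa using hs
      show x = 0
      funext j
      rw [hu j, this j]; simp
    · rintro rfl
      exact ⟨fun j => ⟨0, by simp⟩, fun j => by simp, by simp⟩
  rw [knapVert, this, convexHull_singleton, extremePoints_singleton, Set.ncard_singleton]

/-- Veselov's lower bound: for every `n` there is a positive constant `cₙ` such that for
every `α ≥ 2` there are `a = (a₁,…,aₙ)` and `a₀`, all at most `α`, with
`|𝒩(a,a₀)| ≥ cₙ · (log₂ α)^{n−1}`. -/
theorem exists_knapsack_with_many_vertices (n : ℕ) :
    ∃ c : ℝ, 0 < c ∧ ∀ α : ℕ, 2 ≤ α →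
      ∃ (a : Fin n → ℕ) (a₀ : ℕ), (∀ j, a j ≤ α) ∧ a₀ ≤ α ∧
        c * Real.logb 2 (α : ℝ) ^ (n - 1) ≤ ((knapVert n a a₀).ncard : ℝ) := by
  rcases n with _ | m
  · refine ⟨1, one_pos, fun α hα => ⟨fun _ => 1, 0, fun _ => by show 1 ≤ α; omega, by omega, ?_⟩⟩
    rw [one_vertex]; simp
  simp only [Nat.add_sub_cancel]
  set Q := (m + 2) ^ (m + 1) * 2 ^ m with hQ
  have hQ1 : 1 ≤ Q := Nat.one_le_iff_ne_zero.mpr (by positivity)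
  set R := (m + 2) * (16 * Q ^ 2) with hR
  have hQR : (0 : ℝ) < 8 * (Q : ℝ) := by positivity
  have hT : (0 : ℝ) < (R : ℝ) + 4 * m + 1 := by positivity
  refine ⟨1 / (8 * (Q : ℝ) * ((R : ℝ) + 4 * m + 1) ^ m), by positivity, fun α hα => ?_⟩
  have hlog0 : 0 ≤ Real.logb 2 (α : ℝ) := Real.logb_nonneg (by norm_num) (by exact_mod_cast (by omega : 1 ≤ α))
  have hlog1 : Real.logb 2 (α : ℝ) < (Nat.log 2 α : ℝ) + 1 := by
    rw [Real.logb_lt_iff_lt_rpow (by norm_num) (by exact_mod_cast (by omega : 0 < α))]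
    have := Nat.lt_pow_succ_log_self (b := 2) (by norm_num) α
    exact_mod_cast this
  by_cases hK : (Nat.log 2 α - R) / (2 * m) = 0 ∨ m = 0
  · refine ⟨fun _ => 1, 0, fun _ => by show 1 ≤ α; omega, by omega, ?_⟩
    rw [one_vertex]
    have hle : Real.logb 2 (α : ℝ) ^ m ≤ ((R : ℝ) + 4 * m + 1) ^ m := by
      by_cases hm : m = 0
      · subst hm; simp
      · apply pow_le_pow_left₀ hlog0
        have h := hK.resolve_right hm
        rw [Nat.div_eq_zero_iff] at h
        have : Nat.log 2 α ≤ R + 4 * m := by omega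
        have : (Nat.log 2 α : ℝ) ≤ R + 4 * m := by exact_mod_cast this
        linarith
    rw [div_mul_eq_mul_div, one_mul, div_le_iff₀ (by positivity)]
    have h8 : (1 : ℝ) ≤ 8 * (Q : ℝ) := by
      have : (1 : ℝ) ≤ Q := by exact_mod_cast hQ1
      linarith
    have hpos : 0 ≤ ((R : ℝ) + 4 * m + 1) ^ m := by positivity
    push_cast
    nlinarith
  · push Not at hK
    obtain ⟨hK, hm⟩ := hK
    set K := (Nat.log 2 α - R) / (2 * m) with hKdef
    obtain ⟨p, hpp, hpl, hpu⟩ := Nat.exists_prime_lt_and_le_two_mul (2 * (Q * 2 ^ (m * K))) (by positivity)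
    have : Fact p.Prime := ⟨hpp⟩
    obtain ⟨a, a₀, ha, ha₀, hcount⟩ := many_vertices m K p hpl (by rw [← hQ]; omega)
    have hKm : K * (2 * m) ≤ Nat.log 2 α - R := Nat.div_mul_le_self _ _
    have hlt : Nat.log 2 α - R < 2 * m * (K + 1) := Nat.lt_mul_div_succ _ (by omega)
    have hpos : 0 < K * (2 * m) := by positivity
    have hα' : (m + 2) * p ^ 2 ≤ α := by
      have hp4 : p ≤ 4 * (Q * 2 ^ (m * K)) := by omega
      calc (m + 2) * p ^ 2 ≤ (m + 2) * (4 * (Q * 2 ^ (m * K))) ^ 2 := by gcongr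
        _ = R * 2 ^ (K * (2 * m)) := by rw [hR]; ring
        _ ≤ 2 ^ R * 2 ^ (K * (2 * m)) := Nat.mul_le_mul_right _ (Nat.lt_two_pow_self).le
        _ = 2 ^ (R + K * (2 * m)) := by rw [pow_add]
        _ ≤ 2 ^ (Nat.log 2 α) := Nat.pow_le_pow_right (by norm_num) (by omega)
        _ ≤ α := Nat.pow_log_le_self 2 (by omega)
    have hpα : p ≤ α := by nlinarith [hpp.pos]
    refine ⟨a, a₀, fun j => (ha j).trans hpα, ha₀.trans hα', ?_⟩
    have hcount' : (K : ℝ) ^ m ≤ 8 * (Q : ℝ) * ((knapVert (m + 1) a a₀).ncard : ℝ) := by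
      exact_mod_cast hcount
    have hlK : Real.logb 2 (α : ℝ) ≤ ((R : ℝ) + 4 * m + 1) * K := by
      have h1 : Nat.log 2 α + 1 ≤ R + 2 * m * (K + 1) := by omega
      have hK1 : 1 ≤ K := Nat.one_le_iff_ne_zero.mpr hK
      have h2 : R + 2 * m * (K + 1) ≤ (R + 4 * m + 1) * K := by nlinarith
      have h3 : (Nat.log 2 α : ℝ) + 1 ≤ ((R : ℝ) + 4 * m + 1) * K := by exact_mod_cast h1.trans h2
      linarith
    have hpow : Real.logb 2 (α : ℝ) ^ m ≤ ((R : ℝ) + 4 * m + 1) ^ m * (K : ℝ) ^ m := by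
      rw [← mul_pow]
      exact pow_le_pow_left₀ hlog0 hlK m
    rw [div_mul_eq_mul_div, one_mul, div_le_iff₀ (by positivity)]
    have hTm : 0 ≤ ((R : ℝ) + 4 * m + 1) ^ m := by positivity
    calc _ ≤ _ := hpow
      _ ≤ ((R : ℝ) + 4 * m + 1) ^ m * (8 * (Q : ℝ) * ((knapVert (m + 1) a a₀).ncard : ℝ)) :=
        mul_le_mul_of_nonneg_left hcount' hTm
      _ = _ := by ring
end
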